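/- Let 𝓜 be a moon polyomino with columns c_1,…,c_m from left to right, s=(s_1,…,s_m) a tuple of nonnegative integers, and A a set of rows of 𝓜. Then the major index and the number of north-east chains are equidistributed over F(𝓜,s;A): for every nonnegative integer t, the number of fillings M∈F(𝓜,s;A) with maj(M)=t equals the number of fillings M∈F(𝓜,s;A) with ne(M)=t; equivalently, Σ_{M∈F(𝓜,s;A)} q^{maj(M)} = Σ_{M∈F(𝓜,s;A)} q^{ne(M)}. -/

import Mathlib

open Polynomial

namespace MoonPolyomino

/-- A cell `(r, c)` of `ℤ²`: `r` is the row index (rows increase downwards)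
and `c` is the column index (columns increase to the right). -/
abbrev Cell : Type := ℤ × ℤ

/-- The set of (indices of) rows of a polyomino. -/
def rowSet (P : Finset Cell) : Finset ℤ := P.image Prod.fst

/-- The set of (indices of) columns of a polyomino. -/
def colSet (P : Finset Cell) : Finset ℤ := P.image Prod.snd

/-- The length of row `r` of `P`. -/
def rowLen (P : Finset Cell) (r : ℤ) : ℕ := (P.filter fun x => x.1 = r).card

/-- The length of column `c` of `P`. -/
def colLen (P : Finset Cell) (c : ℤ) : ℕ := (P.filter fun x => x.2 = c).card

def RowConvex (P : Finset Cell) : Prop :=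
  ∀ r c₁ c₂ c : ℤ, (r, c₁) ∈ P → (r, c₂) ∈ P → c₁ ≤ c → c ≤ c₂ → (r, c) ∈ P

def ColConvex (P : Finset Cell) : Prop :=
  ∀ c r₁ r₂ r : ℤ, (r₁, c) ∈ P → (r₂, c) ∈ P → r₁ ≤ r → r ≤ r₂ → (r, c) ∈ P

/-- Any two columns are comparable (the rows met by one form a subset of those met
by the other). -/
def IntersectionFree (P : Finset Cell) : Prop :=
  ∀ c₁ c₂ : ℤ, (∀ r : ℤ, (r, c₁) ∈ P → (r, c₂) ∈ P) ∨ (∀ r : ℤ, (r, c₂) ∈ P → (r, c₁) ∈ P)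

/-- A moon polyomino: a convex intersection-free polyomino. -/
def IsMoon (P : Finset Cell) : Prop := RowConvex P ∧ ColConvex P ∧ IntersectionFree P

/-- A left-aligned stack polyomino: all rows have their leftmost cell in the same column. -/
def LeftAligned (P : Finset Cell) : Prop := ∃ c₀ : ℤ, ∀ x ∈ P, c₀ ≤ x.2 ∧ (x.1, c₀) ∈ P

/-- A top-aligned stack polyomino: all columns have their topmost cell in the same row. -/
def TopAligned (P : Finset Cell) : Prop := ∃ r₀ : ℤ, ∀ x ∈ P, r₀ ≤ x.1 ∧ (r₀, x.2) ∈ P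

/-- A 01-filling of `P`, identified with its set `M` of 1-cells: at most one 1 in each row. -/
def IsFilling (P M : Finset Cell) : Prop :=
  M ⊆ P ∧ ∀ x ∈ M, ∀ y ∈ M, x.1 = y.1 → x = y

open scoped Classical in
/-- `F(𝓜, s; A)`: the 01-fillings of `P` in which column `c` contains exactly `s c` ones
and whose empty rows are exactly the rows in `A`. -/
noncomputable def FillSet (P : Finset Cell) (s : ℤ → ℕ) (A : Finset ℤ) :
    Finset (Finset Cell) :=
  P.powerset.filter fun M =>
    (∀ x ∈ M, ∀ y ∈ M, x.1 = y.1 → x = y) ∧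
    (∀ c ∈ colSet P, (M.filter fun x => x.2 = c).card = s c) ∧
    (∀ r ∈ rowSet P, (r ∈ A ↔ ∀ x ∈ M, x.1 ≠ r))

open scoped Classical in
/-- `ne(M)`: the number of north-east chains, i.e. pairs of 1-cells, one strictly above and
strictly to the right of the other, such that the smallest rectangle containing both lies
in `P`.  In a pair `p`, `p.1` is the lower-left cell and `p.2` the upper-right one. -/
noncomputable def neP (P M : Finset Cell) : ℕ :=
  ((M ×ˢ M).filter fun p =>
      p.2.1 < p.1.1 ∧ p.1.2 < p.2.2 ∧
      ∀ a b : ℤ, p.2.1 ≤ a → a ≤ p.1.1 → p.1.2 ≤ b → b ≤ p.2.2 → (a, b) ∈ P).card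

open scoped Classical in
/-- The descent statistic of a rectangular filling `M`: the number of pairs of 1-cells lying
in consecutive nonempty rows and forming a north-east chain (`p.1` is the cell in the upper
of the two rows, `p.2` the one in the next nonempty row below it). -/
noncomputable def desR (M : Finset Cell) : ℕ :=
  ((M ×ˢ M).filter fun p =>
      p.1.1 < p.2.1 ∧ p.2.2 < p.1.2 ∧ ∀ z ∈ M, ¬ (p.1.1 < z.1 ∧ z.1 < p.2.1)).card

/-- The major index of a rectangular filling `M`: the sum, over the nonempty rows `r`,
of the descent statistic of the restriction of `M` to row `r` and the rows above it. -/
noncomputable def majR (M : Finset Cell) : ℕ :=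
  ∑ y ∈ M, desR (M.filter fun x => x.1 ≤ y.1)

/-- `R` is a (nonempty) combinatorial rectangle. -/
def IsRect (R : Finset Cell) : Prop :=
  ∃ r₁ r₂ c₁ c₂ : ℤ, r₁ ≤ r₂ ∧ c₁ ≤ c₂ ∧ R = Finset.Icc r₁ r₂ ×ˢ Finset.Icc c₁ c₂

/-- `R` is a maximal rectangle contained in `P`. -/
def IsMaxRect (P R : Finset Cell) : Prop :=
  IsRect R ∧ R ⊆ P ∧ ∀ R' : Finset Cell, IsRect R' → R' ⊆ P → R ⊆ R' → R' = R

open scoped Classical in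
/-- The set of maximal rectangles contained in `P`. -/
noncomputable def maxRects (P : Finset Cell) : Finset (Finset Cell) :=
  P.powerset.filter fun R => IsMaxRect P R

/-- The height (number of rows) of a rectangle. -/
def nRows (R : Finset Cell) : ℕ := (R.image Prod.fst).card

open scoped Classical in
/-- The major index of a filling `M` of a moon polyomino `P`:
`maj(M) = Σᵢ maj(Rᵢ) − Σᵢ maj(Rᵢ ∩ Rᵢ₊₁)`, where `R₁, …, R_r` are the restrictions of `M`
to the maximal rectangles of `P` listed in increasing order of height (in a moon polyomino
the maximal rectangles have pairwise distinct heights; the consecutive pairs are exactly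
the pairs of maximal rectangles with no maximal rectangle of intermediate height). -/
noncomputable def majP (P M : Finset Cell) : ℕ :=
  (∑ R ∈ maxRects P, majR (M ∩ R)) -
    ∑ p ∈ (maxRects P ×ˢ maxRects P).filter
        (fun p => nRows p.1 < nRows p.2 ∧
          ∀ T ∈ maxRects P, ¬ (nRows p.1 < nRows T ∧ nRows T < nRows p.2)),
      majR (M ∩ p.1 ∩ p.2)

/-- `c` belongs to the right part `Right(𝓜)` of `P`: every column strictly to its right
is at most as long as `c`. -/
def InRightPart (P : Finset Cell) (c : ℤ) : Prop :=
  ∀ d ∈ colSet P, c < d → colLen P d ≤ colLen P c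

/-- The total order `≺` on the columns of a moon polyomino. -/
def colPrec (P : Finset Cell) (c d : ℤ) : Prop :=
  colLen P c < colLen P d ∨
    (colLen P c = colLen P d ∧
      ((¬ InRightPart P c ∧ InRightPart P d) ∨
       (¬ InRightPart P c ∧ ¬ InRightPart P d ∧ c < d) ∨
       (InRightPart P c ∧ InRightPart P d ∧ d < c)))

open scoped Classical in
/-- `h_c = |c| − a_c − Σ_{d ≺ c} s_d`, where `a_c` is the number of rows of `A`
meeting column `c`. -/
noncomputable def hVal (P : Finset Cell) (s : ℤ → ℕ) (A : Finset ℤ) (c : ℤ) : ℤ :=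
  (colLen P c : ℤ) - ((A.filter fun r => (r, c) ∈ P).card : ℤ)
    - ∑ d ∈ (colSet P).filter (fun d => colPrec P d c), (s d : ℤ)

open scoped Classical in
/-- The Gaussian binomial coefficient
`[h choose s]_q = Σ_{0 ≤ i₁ ≤ ⋯ ≤ i_s ≤ h−s} q^{i₁+⋯+i_s}` as a polynomial in `q = X`. -/
noncomputable def gaussBinom (h : ℤ) (s : ℕ) : Polynomial ℤ :=
  ∑ f ∈ (Fintype.piFinset fun _ : Fin s => Finset.Icc (0 : ℤ) (h - s)).filter
      (fun f => Monotone f),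
    Polynomial.X ^ (∑ i, f i).toNat

/-- The major index of a word: `maj(w) = Σ_{i ∈ Des(w)} i` (positions are 1-based). -/
def majW (w : List ℕ) : ℕ :=
  ∑ i ∈ Finset.range (w.length - 1), if w.getD (i + 1) 0 < w.getD i 0 then i + 1 else 0

/-- The descent number of a word. -/
def desW (w : List ℕ) : ℕ :=
  ∑ i ∈ Finset.range (w.length - 1), if w.getD (i + 1) 0 < w.getD i 0 then 1 else 0

/-- `w'` is obtained from `w` by inserting `m` copies of the letter `a` (where `a` does not
occur in `w`): `w'` has length `k + m`, exactly `m` letters equal to `a`, and its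
subsequence of letters different from `a` is `w`. -/
def IsInsertion (w : List ℕ) (a m : ℕ) (w' : List ℕ) : Prop :=
  w'.length = w.length + m ∧ w'.count a = m ∧ w'.filter (fun x => decide (x ≠ a)) = w

open scoped Classical in
/-- The weakly increasing `m`-tuples `0 ≤ i₁ ≤ ⋯ ≤ i_m ≤ k`. -/
noncomputable def monoTuples (m k : ℕ) : Finset (Fin m → ℕ) :=
  (Fintype.piFinset fun _ : Fin m => Finset.range (k + 1)).filter fun f => Monotone f


/-! ### Words -/

def majL : List ℤ → ℕ
  | [] => 0
  | [_] => 0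
  | x :: y :: t => (if y < x then t.length + 1 else 0) + majL (y :: t)

noncomputable def gb : ℕ → ℕ → ℤ[X]
  | 0, _ => 1
  | _ + 1, 0 => 1
  | k + 1, m + 1 => gb (k + 1) m + X ^ (m + 1) * gb k (m + 1)

lemma gb_zero_right (k : ℕ) : gb k 0 = 1 := by cases k <;> simp [gb]
lemma gb_zero_left (m : ℕ) : gb 0 m = 1 := by simp [gb]
lemma gb_succ (k m : ℕ) : gb (k + 1) (m + 1) = gb (k + 1) m + X ^ (m + 1) * gb k (m + 1) := by
  rw [gb]

lemma gb_zero_succ' (m : ℕ) : gb 1 (m+1) = X * gb 1 m + 1 := by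
  induction m with
  | zero => simp [gb_succ, gb_zero_left, gb_zero_right]; ring
  | succ m ih =>
    rw [gb_succ 0 (m+1), gb_zero_left]
    nth_rewrite 1 [ih]
    rw [gb_succ 0 m, gb_zero_left]; ring

lemma gb_succ' (k m : ℕ) : gb (k + 1) (m + 1) = X ^ (k + 1) * gb (k + 1) m + gb k (m + 1) := by
  induction k generalizing m with
  | zero => rw [gb_zero_succ', gb_zero_left]; ring
  | succ k ihk =>
    induction m with
    | zero =>
      rw [gb_succ, gb_zero_right, ihk 0, gb_zero_right]
      have h := gb_succ k 0
      rw [ihk 0] at h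
      simp only [gb_zero_right] at h
      linear_combination -h
    | succ m ihm =>
      linear_combination gb_succ (k+1) (m+1) + ihm + X ^ (m+2) * ihk (m+1)
        - X ^ (k+2) * gb_succ (k+1) m - gb_succ k (m+1)

def ins (c : ℤ) : List ℤ → ℕ → Finset (List ℤ)
  | [], m => {List.replicate m c}
  | x :: w, 0 => {x :: w}
  | x :: w, m + 1 => (ins c (x :: w) m).image (fun u => c :: u) ∪
      (ins c w (m + 1)).image (fun u => x :: u)
termination_by w m => w.length + m

lemma mem_ins (c : ℤ) (w : List ℤ) (m : ℕ) (hw : c ∉ w) (u : List ℤ) :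
    u ∈ ins c w m ↔ u.filter (· ≠ c) = w ∧ u.count c = m := by
  induction w, m using ins.induct generalizing u with
  | case1 m =>
    simp only [ins, Finset.mem_singleton, List.filter_eq_nil_iff]
    constructor
    · rintro rfl; simp
    · rintro ⟨h1, h2⟩
      have h3 : ∀ a ∈ u, a = c := fun a ha => by simpa using h1 a ha
      rw [← h2, List.count_eq_length.2 (fun a ha => (h3 a ha).symm), List.eq_replicate_iff]
      exact ⟨rfl, h3⟩
  | case2 x w =>
    simp only [ins, Finset.mem_singleton]
    constructor
    · rintro rfl
      refine ⟨?_, List.count_eq_zero.2 hw⟩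
      rw [List.filter_eq_self]
      intro a ha
      simp; rintro rfl; exact hw ha
    · rintro ⟨h1, h2⟩
      rw [← h1, eq_comm, List.filter_eq_self]
      intro a ha
      simp; rintro rfl; exact (List.count_eq_zero.1 h2) ha
  | case3 x w m ih1 ih2 => 
    rw [ins]
    simp only [List.mem_cons, not_or] at hw
    simp only [Finset.mem_union, Finset.mem_image]
    constructor
    · rintro (⟨v, hv, rfl⟩ | ⟨v, hv, rfl⟩)
      · rw [ih1 (by simp [hw])] at hv
        simp_all
      · rw [ih2 hw.2] at hv
        have : x ≠ c := fun h => hw.1 h.symm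
        simp_all
    · rintro ⟨h1, h2⟩
      cases u with
      | nil => simp at h1
      | cons y u =>
        by_cases hy : y = c
        · left; refine ⟨u, (ih1 (by simp [hw]) u).2 ?_, by rw [hy]⟩
          simp_all
        · right
          simp [hy] at h1 h2
          refine ⟨u, (ih2 hw.2 u).2 ?_, by rw [h1.1]⟩
          simp_all

lemma length_of_mem_ins {c : ℤ} {w : List ℤ} {m : ℕ} {u : List ℤ} (h : u ∈ ins c w m) :
    u.length = w.length + m := by
  induction w, m using ins.induct generalizing u with
  | case1 m => simp [ins] at h; simp [h]
  | case2 x w => simp [ins] at h; simp [h]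
  | case3 x w m ih1 ih2 =>
    rw [ins] at h
    simp only [Finset.mem_union, Finset.mem_image] at h
    rcases h with ⟨v, hv, rfl⟩ | ⟨v, hv, rfl⟩
    · have := ih1 hv; simp at *; omega
    · have := ih2 hv; simp at *; omega

lemma sum_ins_cons (c x : ℤ) (w : List ℤ) (m : ℕ) (hx : x ≠ c) (F : List ℤ → ℤ[X]) :
    ∑ u ∈ ins c (x :: w) (m + 1), F u
      = ∑ u ∈ ins c (x :: w) m, F (c :: u) + ∑ u ∈ ins c w (m + 1), F (x :: u) := by
  rw [ins, Finset.sum_union, Finset.sum_image, Finset.sum_image]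
  · intro a _ b _ h; simpa using h
  · intro a _ b _ h; simpa using h
  · rw [Finset.disjoint_left]
    rintro u h1 h2
    simp only [Finset.mem_image] at h1 h2
    obtain ⟨v, _, rfl⟩ := h1
    obtain ⟨v', _, h⟩ := h2
    simp at h; exact hx h.1

lemma majL_le_cons (c : ℤ) (u : List ℤ) : majL u ≤ majL (c :: u) := by
  cases u <;> simp [majL]

lemma majL_cons_of_le (c : ℤ) (u : List ℤ) (h : ∀ y ∈ u, c ≤ y) : majL (c :: u) = majL u := by
  cases u with
  | nil => simp [majL]
  | cons y t => have := h y (by simp); simp [majL]; omega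

lemma majL_cons_mono {a b : ℤ} (h : a ≤ b) (u : List ℤ) : majL (a :: u) ≤ majL (b :: u) := by
  cases u with
  | nil => simp [majL]
  | cons y t => simp only [majL]; split_ifs <;> omega

lemma majL_cons_le (b : ℤ) (u : List ℤ) : majL (b :: u) ≤ u.length + majL u := by
  cases u with
  | nil => simp [majL]
  | cons y t => simp only [majL]; split_ifs <;> simp

lemma majL_sublist_cons {u v : List ℤ} (h : u.Sublist v) (a : ℤ) : majL (a :: u) ≤ majL (a :: v) := by
  induction h generalizing a with
  | slnil => simp
  | @cons l1 l2 b h ih =>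
    by_cases hab : b < a
    · have h1 := majL_cons_le a l1
      have h2 := ih b
      have h3 := majL_le_cons b l1
      have h4 := h.length_le
      simp only [majL, hab, if_true]; omega
    · have h1 := majL_cons_mono (not_lt.1 hab) l1
      have h2 := ih b
      simp only [majL, hab, if_false]; omega
  | @cons_cons l1 l2 b h ih =>
    have h2 := ih b
    have h4 := h.length_le
    simp only [majL]; split_ifs <;> omega

lemma majL_sublist {u v : List ℤ} (h : u.Sublist v) : majL u ≤ majL v := by
  induction h with
  | slnil => simp
  | @cons l1 l2 b h ih => exact ih.trans (majL_le_cons _ _)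
  | @cons_cons l1 l2 b h ih => exact majL_sublist_cons h b

lemma letters_of_mem_ins {c : ℤ} {w : List ℤ} {m : ℕ} {u : List ℤ} (h : u ∈ ins c w m) :
    ∀ y ∈ u, y = c ∨ y ∈ w := by
  induction w, m using ins.induct generalizing u with
  | case1 m => simp [ins] at h; subst h; simp
  | case2 x w => simp [ins] at h; subst h; intro y hy; exact Or.inr hy
  | case3 x w m ih1 ih2 =>
    rw [ins] at h
    simp only [Finset.mem_union, Finset.mem_image] at h
    rcases h with ⟨v, hv, rfl⟩ | ⟨v, hv, rfl⟩
    · have := ih1 hv; simp at *; exact this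
    · have := ih2 hv; simp at *; grind

lemma majL_replicate (c : ℤ) (m : ℕ) : majL (List.replicate m c) = 0 := by
  induction m with
  | zero => simp [majL]
  | succ m ih => rw [List.replicate_succ, majL_cons_of_le, ih]; simp

lemma sum_maj_min (c : ℤ) (w : List ℤ) (m : ℕ) (hw : ∀ y ∈ w, c < y) :
    ∑ u ∈ ins c w m, (X : ℤ[X]) ^ majL u = X ^ majL w * gb w.length m ∧
    ∀ x, c < x → ∑ u ∈ ins c w m, (X : ℤ[X]) ^ majL (x :: u)
      = X ^ majL (x :: w) * X ^ m * gb w.length m := by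
  induction w, m using ins.induct with
  | case1 m =>
    simp [ins, majL_replicate, majL, gb_zero_left]
    intro x hx
    cases m with
    | zero => simp [majL]
    | succ m => rw [List.replicate_succ, majL, ← List.replicate_succ, majL_replicate]; simp [hx]
  | case2 x w => simp [ins, gb_zero_right]
  | case3 x w m ih1 ih2 =>
    have hx : c < x := hw x (by simp)
    obtain ⟨i1, -⟩ := ih1 hw
    obtain ⟨-, i2⟩ := ih2 (fun y hy => hw y (by simp [hy]))
    have hc : ∀ u ∈ ins c (x :: w) m, majL (c :: u) = majL u := by
      intro u hu
      apply majL_cons_of_le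
      intro y hy
      rcases letters_of_mem_ins hu y hy with rfl | h
      · exact le_rfl
      · exact (hw y h).le
    constructor
    · rw [sum_ins_cons _ _ _ _ hx.ne', i2 x hx,
        Finset.sum_congr rfl (fun u hu => by rw [hc u hu]), i1, List.length_cons, gb_succ]
      ring
    · intro z hz
      rw [sum_ins_cons _ _ _ _ hx.ne']
      have e1 : ∑ u ∈ ins c (x :: w) m, (X : ℤ[X]) ^ majL (z :: c :: u)
          = X ^ (w.length + m + 2) * ∑ u ∈ ins c (x :: w) m, (X : ℤ[X]) ^ majL u := by
        rw [Finset.mul_sum]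
        refine Finset.sum_congr rfl fun u hu => ?_
        have := length_of_mem_ins hu
        simp only [majL, hz, if_true, hc u hu, this, List.length_cons]
        rw [← pow_add]; congr 1; omega
      have e2 : ∑ u ∈ ins c w (m+1), (X : ℤ[X]) ^ majL (z :: x :: u)
          = X ^ (if x < z then w.length + m + 2 else 0) * ∑ u ∈ ins c w (m+1), (X : ℤ[X]) ^ majL (x :: u) := by
        rw [Finset.mul_sum]
        refine Finset.sum_congr rfl fun u hu => ?_
        have := length_of_mem_ins hu
        simp only [majL, this]
        rw [← pow_add]; congr 2
      rw [e1, e2, i1, i2 x hx, List.length_cons]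
      simp only [majL, Nat.succ_eq_add_one]
      split_ifs
      · rw [gb_succ]; ring
      · rw [gb_succ']; ring

lemma sum_maj_max (c : ℤ) (w : List ℤ) (m : ℕ) (hw : ∀ y ∈ w, y < c) :
    ∑ u ∈ ins c w m, (X : ℤ[X]) ^ majL u = X ^ majL w * gb w.length m ∧
    ∑ u ∈ ins c w m, (X : ℤ[X]) ^ majL (c :: u) = X ^ majL w * X ^ w.length * gb w.length m ∧
    ∀ x, x < c → ∑ u ∈ ins c w m, (X : ℤ[X]) ^ majL (x :: u)
      = X ^ majL (x :: w) * gb w.length m := by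
  induction w, m using ins.induct with
  | case1 m =>
    simp [ins, majL_replicate, majL, gb_zero_left]
    refine ⟨?_, fun x hx => ?_⟩
    · rw [← List.replicate_succ, majL_replicate]; simp
    · rw [majL_cons_of_le, majL_replicate]; simp
      intro y hy; rw [List.eq_of_mem_replicate hy]; exact hx.le
  | case2 x w =>
    have := hw x (by simp)
    simp [ins, gb_zero_right, majL, this, pow_add, mul_comm]
  | case3 x w m ih1 ih2 =>
    have hx : x < c := hw x (by simp)
    obtain ⟨-, i1, -⟩ := ih1 hw
    obtain ⟨-, -, i2⟩ := ih2 (fun y hy => hw y (by simp [hy]))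
    have e2 : ∀ z, ∑ u ∈ ins c w (m+1), (X : ℤ[X]) ^ majL (z :: x :: u)
          = X ^ (if x < z then w.length + m + 2 else 0) * ∑ u ∈ ins c w (m+1), (X : ℤ[X]) ^ majL (x :: u) := by
        intro z
        rw [Finset.mul_sum]
        refine Finset.sum_congr rfl fun u hu => ?_
        have := length_of_mem_ins hu
        simp only [majL, this]
        rw [← pow_add]; congr 2
    have e1 : ∀ z ≤ c, ∑ u ∈ ins c (x :: w) m, (X : ℤ[X]) ^ majL (z :: c :: u)
        = ∑ u ∈ ins c (x :: w) m, (X : ℤ[X]) ^ majL (c :: u) := by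
      intro z hz
      refine Finset.sum_congr rfl fun u hu => ?_
      simp [majL, not_lt.2 hz]
    refine ⟨?_, ?_, ?_⟩
    · rw [sum_ins_cons _ _ _ _ hx.ne, i2 x hx, i1, List.length_cons, gb_succ']
      ring
    · rw [sum_ins_cons _ _ _ _ hx.ne, e1 c le_rfl, e2 c, i1, i2 x hx, List.length_cons, gb_succ]
      simp only [hx, if_true]; ring
    · intro z hz
      rw [sum_ins_cons _ _ _ _ hx.ne, e1 z hz.le, e2 z, i1, i2 x hx, List.length_cons]
      simp only [majL, Nat.succ_eq_add_one]
      split_ifs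
      · rw [gb_succ]; ring
      · rw [gb_succ']; ring

def pairL (Q : ℤ → ℤ → Bool) : List ℤ → ℕ
  | [] => 0
  | x :: u => u.countP (Q x) + pairL Q u

def Qc (c : ℤ) (x y : ℤ) : Bool := y < x ∧ (x = c ∨ y = c)

lemma pairL_of_not_mem (c : ℤ) (w : List ℤ) (h : c ∉ w) : pairL (Qc c) w = 0 := by
  induction w with
  | nil => rfl
  | cons x w ih =>
    simp only [List.mem_cons, not_or] at h
    simp only [pairL, ih h.2, add_zero, List.countP_eq_zero, Qc]
    intro y hy; simp; intro _
    exact ⟨fun e => h.1 e.symm, fun e => h.2 (e ▸ hy)⟩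

lemma pairL_replicate (c : ℤ) (m : ℕ) : pairL (Qc c) (List.replicate m c) = 0 := by
  induction m with
  | zero => rfl
  | succ m ih => simp [List.replicate_succ, pairL, ih, Qc]

lemma count_of_mem_ins {c : ℤ} {w : List ℤ} {m : ℕ} {u : List ℤ} (hw : c ∉ w) (h : u ∈ ins c w m) :
    u.count c = m := ((mem_ins c w m hw u).1 h).2

lemma sum_ne_min (c : ℤ) (w : List ℤ) (m : ℕ) (hw : ∀ y ∈ w, c < y) :
    ∑ u ∈ ins c w m, (X : ℤ[X]) ^ pairL (Qc c) u = gb w.length m := by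
  induction w, m using ins.induct with
  | case1 m => simp [ins, gb_zero_left, pairL_replicate]
  | case2 x w =>
    simp only [ins, Finset.sum_singleton, gb_zero_right]
    rw [pairL_of_not_mem, pow_zero]
    intro h; exact lt_irrefl _ (hw c h)
  | case3 x w m ih1 ih2 =>
    have hx : c < x := hw x (by simp)
    have hw2 : ∀ y ∈ w, c < y := (fun y hy => hw y (by simp [hy]))
    have i1 := ih1 hw
    have i2 := ih2 hw2
    rw [sum_ins_cons _ _ _ _ hx.ne', List.length_cons, gb_succ, ← i2]
    rw [List.length_cons] at i1
    rw [← i1, Finset.mul_sum]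
    congr 1
    · refine Finset.sum_congr rfl fun u hu => ?_
      congr 1
      simp only [pairL, Nat.add_eq_right, List.countP_eq_zero, Qc]
      intro y hy
      rcases letters_of_mem_ins hu y hy with rfl | h
      · simp
      · have := hw y h; simp; omega
    · refine Finset.sum_congr rfl fun u hu => ?_
      rw [← pow_add]
      congr 1
      simp only [pairL]
      congr 1
      rw [← count_of_mem_ins (fun h => lt_irrefl _ (hw2 c h)) hu, List.count]
      apply List.countP_congr
      intro y hy
      simp [Qc]; constructor
      · rintro ⟨h1, h2 | h2⟩ <;> omega
      · rintro rfl; simp [hx]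

lemma sum_ne_max (c : ℤ) (w : List ℤ) (m : ℕ) (hw : ∀ y ∈ w, y < c) :
    ∑ u ∈ ins c w m, (X : ℤ[X]) ^ pairL (Qc c) u = gb w.length m := by
  induction w, m using ins.induct with
  | case1 m => simp [ins, gb_zero_left, pairL_replicate]
  | case2 x w =>
    simp only [ins, Finset.sum_singleton, gb_zero_right]
    rw [pairL_of_not_mem, pow_zero]
    intro h; exact lt_irrefl _ (hw c h)
  | case3 x w m ih1 ih2 =>
    have hx : x < c := hw x (by simp)
    have hw2 : ∀ y ∈ w, y < c := (fun y hy => hw y (by simp [hy]))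
    have i1 := ih1 hw
    have i2 := ih2 hw2
    have hcw : c ∉ x :: w := fun h => lt_irrefl _ (hw c h)
    rw [sum_ins_cons _ _ _ _ hx.ne, List.length_cons, gb_succ', ← i2]
    rw [List.length_cons] at i1
    rw [← i1, Finset.mul_sum]
    congr 1
    · refine Finset.sum_congr rfl fun u hu => ?_
      rw [← pow_add]
      congr 1
      simp only [pairL]
      congr 1
      have h1 := ((mem_ins c _ m hcw u).1 hu).1
      have h2 : (x :: w).length = w.length + 1 := rfl
      rw [← h2, ← h1, List.countP_eq_length_filter]
      congr 1
      apply List.filter_congr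
      intro y hy
      rcases letters_of_mem_ins hu y hy with rfl | h
      · simp [Qc]
      · have := hw y h
        have hne : y ≠ c := by omega
        simp [Qc, this, hne]
    · refine Finset.sum_congr rfl fun u hu => ?_
      congr 1
      simp only [pairL, Nat.add_eq_right, List.countP_eq_zero, Qc]
      intro y hy
      simp; intro h; constructor <;> omega

/-! ### The abstract word model -/

def mid (a b : ℕ) (v : List ℤ) : List ℤ := (v.drop a).take (v.length - a - b)

lemma split_mid (a b : ℕ) (v : List ℤ) (h : a + b ≤ v.length) :
    v.take a ++ mid a b v ++ v.drop (v.length - b) = v := by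
  have e : v.drop (v.length - b) = (v.drop a).drop (v.length - a - b) := by
    rw [List.drop_drop]; congr 1; omega
  rw [e, mid, List.append_assoc, List.take_append_drop, List.take_append_drop]

lemma mid_append {a b : ℕ} {x u y : List ℤ} (hx : x.length = a) (hy : y.length = b) :
    mid a b (x ++ u ++ y) = u := by
  subst hx hy
  rw [mid, List.append_assoc, List.drop_left, List.take_left']
  simp

lemma length_mid {a b : ℕ} {v : List ℤ} : (mid a b v).length = v.length - a - b := by
  simp [mid]

lemma mem_of_mem_mid {a b : ℕ} {v : List ℤ} {y : ℤ} (h : y ∈ mid a b v) : y ∈ v :=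
  List.mem_of_mem_drop (List.mem_of_mem_take h)

def LL (a b s : ℤ → ℕ) : List ℤ → Finset (List ℤ)
  | [] => {[]}
  | c :: cs => ((LL a b s cs).filter (fun v => a c + b c ≤ v.length)).biUnion fun v =>
      (ins c (mid (a c) (b c) v) (s c)).image
        (fun u => v.take (a c) ++ u ++ v.drop (v.length - b c))

def majD (a b : ℤ → ℕ) : List ℤ → List ℤ → ℕ
  | [], _ => 0
  | c :: cs, v => (majL (mid (a c) (b c) v) - majL ((mid (a c) (b c) v).filter (· ≠ c)))
      + majD a b cs (v.filter (· ≠ c))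

def neD (a b : ℤ → ℕ) : List ℤ → List ℤ → ℕ
  | [], _ => 0
  | c :: cs, v => pairL (Qc c) (mid (a c) (b c) v) + neD a b cs (v.filter (· ≠ c))

/-- each letter is smaller than all the later ones or bigger than all the later ones -/
def Ext : List ℤ → Prop
  | [] => True
  | c :: cs => ((∀ d ∈ cs, c < d) ∨ (∀ d ∈ cs, d < c)) ∧ Ext cs

lemma letters_LL (a b s : ℤ → ℕ) (cs : List ℤ) : ∀ v ∈ LL a b s cs, ∀ y ∈ v, y ∈ cs := by
  induction cs with
  | nil => simp [LL]
  | cons c cs ih =>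
    intro v hv y hy
    simp only [LL, Finset.mem_biUnion, Finset.mem_filter, Finset.mem_image] at hv
    obtain ⟨v', ⟨hv', hl⟩, u, hu, rfl⟩ := hv
    simp only [List.mem_append] at hy
    rcases hy with (hy | hy) | hy
    · exact List.mem_cons_of_mem _ (ih v' hv' y (List.mem_of_mem_take hy))
    · rcases letters_of_mem_ins hu y hy with rfl | h
      · simp
      · exact List.mem_cons_of_mem _ (ih v' hv' y (mem_of_mem_mid h))
    · exact List.mem_cons_of_mem _ (ih v' hv' y (List.mem_of_mem_drop hy))

lemma length_LL (a b s : ℤ → ℕ) (cs : List ℤ) : ∀ v ∈ LL a b s cs, v.length = (cs.map s).sum := by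
  induction cs with
  | nil => simp [LL]
  | cons c cs ih =>
    intro v hv
    simp only [LL, Finset.mem_biUnion, Finset.mem_filter, Finset.mem_image] at hv
    obtain ⟨v', ⟨hv', hl⟩, u, hu, rfl⟩ := hv
    have h1 := length_of_mem_ins hu
    have h2 := ih v' hv'
    have h3 := @length_mid (a c) (b c) v'
    simp; omega

lemma filter_ne_self {c : ℤ} {x : List ℤ} (h : c ∉ x) : x.filter (· ≠ c) = x := by
  rw [List.filter_eq_self]
  intro y hy; simp; rintro rfl; exact h hy

/-- data about one piece of the union -/
lemma piece {c : ℤ} {a b m : ℕ} {v u : List ℤ} (hc : c ∉ v) (hl : a + b ≤ v.length)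
    (hu : u ∈ ins c (mid a b v) m) :
    mid a b (v.take a ++ u ++ v.drop (v.length - b)) = u ∧
    u.filter (· ≠ c) = mid a b v ∧
    (v.take a ++ u ++ v.drop (v.length - b)).filter (· ≠ c) = v ∧ u.count c = m := by
  have hm : c ∉ mid a b v := fun h => hc (mem_of_mem_mid h)
  have h1 := (mem_ins c _ m hm u).1 hu
  refine ⟨mid_append (by simp; omega) (by simp; omega), h1.1, ?_, h1.2⟩
  rw [List.filter_append, List.filter_append, h1.1,
    filter_ne_self (fun h => hc (List.mem_of_mem_take h)),
    filter_ne_self (fun h => hc (List.mem_of_mem_drop h)), split_mid _ _ _ hl]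

lemma sum_LL_cons (a b s : ℤ → ℕ) (c : ℤ) (cs : List ℤ) (hc : c ∉ cs) (F : List ℤ → ℤ[X]) :
    ∑ v ∈ LL a b s (c :: cs), F v =
      ∑ v ∈ (LL a b s cs).filter (fun v => a c + b c ≤ v.length),
        ∑ u ∈ ins c (mid (a c) (b c) v) (s c), F (v.take (a c) ++ u ++ v.drop (v.length - b c)) := by
  have hcv : ∀ v ∈ LL a b s cs, c ∉ v := fun v hv h => hc (letters_LL a b s cs v hv c h)
  rw [LL, Finset.sum_biUnion]
  · refine Finset.sum_congr rfl fun v hv => ?_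
    rw [Finset.sum_image]
    intro u _ u' _ h
    simpa using h
  · intro v hv v' hv' hne
    simp only [Finset.coe_filter, Set.mem_ofPred_eq] at hv hv'
    rw [Function.onFun, Finset.disjoint_left]
    intro t h1 h2
    simp only [Finset.mem_image] at h1 h2
    obtain ⟨u, hu, rfl⟩ := h1
    obtain ⟨u', hu', h⟩ := h2
    apply hne
    rw [← (piece (hcv v hv.1) hv.2 hu).2.2.1, ← (piece (hcv v' hv'.1) hv'.2 hu').2.2.1, h]

lemma equi_LL (a b s : ℤ → ℕ) (cs : List ℤ) (he : Ext cs) :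
    ∑ v ∈ LL a b s cs, (X : ℤ[X]) ^ majD a b cs v = ∑ v ∈ LL a b s cs, (X : ℤ[X]) ^ neD a b cs v := by
  induction cs with
  | nil => simp [LL, majD, neD]
  | cons c cs ih =>
    obtain ⟨h1, h2⟩ := he
    have hc : c ∉ cs := by
      rcases h1 with h | h <;> exact fun hh => lt_irrefl _ (h c hh)
    have hcv : ∀ v ∈ LL a b s cs, c ∉ v := fun v hv h => hc (letters_LL a b s cs v hv c h)
    rw [sum_LL_cons _ _ _ _ _ hc, sum_LL_cons _ _ _ _ _ hc]
    have key : ∀ v ∈ (LL a b s cs).filter (fun v => a c + b c ≤ v.length),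
        (∑ u ∈ ins c (mid (a c) (b c) v) (s c),
          (X : ℤ[X]) ^ majL u = X ^ majL (mid (a c) (b c) v) * gb ((cs.map s).sum - a c - b c) (s c)) ∧
        (∑ u ∈ ins c (mid (a c) (b c) v) (s c),
          (X : ℤ[X]) ^ pairL (Qc c) u = gb ((cs.map s).sum - a c - b c) (s c)) := by
      intro v hv
      rw [Finset.mem_filter] at hv
      rw [← length_LL a b s cs v hv.1, ← length_mid]
      have hlet : ∀ y ∈ mid (a c) (b c) v, y ∈ cs :=
        fun y hy => letters_LL a b s cs v hv.1 y (mem_of_mem_mid hy)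
      rcases h1 with h | h
      · exact ⟨(sum_maj_min c _ _ (fun y hy => h y (hlet y hy))).1,
          sum_ne_min c _ _ (fun y hy => h y (hlet y hy))⟩
      · exact ⟨(sum_maj_max c _ _ (fun y hy => h y (hlet y hy))).1,
          sum_ne_max c _ _ (fun y hy => h y (hlet y hy))⟩
    have k1 : ∀ v ∈ (LL a b s cs).filter (fun v => a c + b c ≤ v.length),
        ∑ u ∈ ins c (mid (a c) (b c) v) (s c),
          (X : ℤ[X]) ^ majD a b (c :: cs) (v.take (a c) ++ u ++ v.drop (v.length - b c))
        = X ^ majD a b cs v * gb ((cs.map s).sum - a c - b c) (s c) := by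
      intro v hv
      have hk := (key v hv).1
      rw [Finset.mem_filter] at hv
      have hX : (X : ℤ[X]) ^ majL (mid (a c) (b c) v) ≠ 0 := pow_ne_zero _ X_ne_zero
      apply mul_left_cancel₀ hX
      rw [mul_left_comm, ← hk, Finset.mul_sum, Finset.mul_sum]
      refine Finset.sum_congr rfl fun u hu => ?_
      obtain ⟨p1, p2, p3, -⟩ := piece (hcv v hv.1) hv.2 hu
      rw [majD, p1, p2, p3, ← pow_add, ← pow_add]
      have : majL (mid (a c) (b c) v) ≤ majL u := by
        rw [← p2]; exact majL_sublist List.filter_sublist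
      congr 1; omega
    have k2 : ∀ v ∈ (LL a b s cs).filter (fun v => a c + b c ≤ v.length),
        ∑ u ∈ ins c (mid (a c) (b c) v) (s c),
          (X : ℤ[X]) ^ neD a b (c :: cs) (v.take (a c) ++ u ++ v.drop (v.length - b c))
        = X ^ neD a b cs v * gb ((cs.map s).sum - a c - b c) (s c) := by
      intro v hv
      have hk := (key v hv).2
      rw [Finset.mem_filter] at hv
      rw [← hk, Finset.mul_sum]
      refine Finset.sum_congr rfl fun u hu => ?_
      obtain ⟨p1, p2, p3, -⟩ := piece (hcv v hv.1) hv.2 hu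
      rw [neD, p1, p3, ← pow_add, add_comm]
    rw [Finset.sum_congr rfl k1, Finset.sum_congr rfl k2, ← Finset.sum_mul, ← Finset.sum_mul]
    congr 1
    by_cases hle : a c + b c ≤ (cs.map s).sum
    · rw [Finset.filter_true_of_mem, ih h2]
      intro v hv; rw [length_LL a b s cs v hv]; exact hle
    · rw [Finset.filter_false_of_mem]
      · simp
      · intro v hv; rw [length_LL a b s cs v hv]; exact hle

/-- Explicit description of the elements of `LL`. -/
lemma mem_LL_cons (a b s : ℤ → ℕ) (c : ℤ) (cs : List ℤ) (hc : c ∉ cs) (v : List ℤ) :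
    v ∈ LL a b s (c :: cs) ↔ v.filter (· ≠ c) ∈ LL a b s cs ∧ v.count c = s c ∧
      ∃ x u y, v = x ++ u ++ y ∧ x.length = a c ∧ y.length = b c ∧ c ∉ x ∧ c ∉ y := by
  have hcv : ∀ v ∈ LL a b s cs, c ∉ v := fun v hv h => hc (letters_LL a b s cs v hv c h)
  rw [LL]
  simp only [Finset.mem_biUnion, Finset.mem_filter, Finset.mem_image]
  constructor
  · rintro ⟨v', ⟨hv', hl⟩, u, hu, rfl⟩
    obtain ⟨p1, p2, p3, p4⟩ := piece (hcv v' hv') hl hu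
    have q1 : c ∉ v'.take (a c) := (fun h => hcv v' hv' (List.mem_of_mem_take h))
    have q2 : c ∉ v'.drop (v'.length - b c) := (fun h => hcv v' hv' (List.mem_of_mem_drop h))
    refine ⟨by rw [p3]; exact hv', ?_, _, _, _, rfl, by simp; omega, by simp; omega, q1, q2⟩
    rw [List.count_append, List.count_append, p4, List.count_eq_zero.2 q1, List.count_eq_zero.2 q2]
    simp
  · rintro ⟨h1, h2, x, u, y, rfl, hx, hy, hcx, hcy⟩
    refine ⟨_, ⟨h1, ?_⟩, u, ?_, ?_⟩
    · rw [List.filter_append, List.filter_append, filter_ne_self hcx, filter_ne_self hcy]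
      simp; omega
    · rw [List.filter_append, List.filter_append, filter_ne_self hcx, filter_ne_self hcy,
        mid_append hx hy, mem_ins _ _ _ (by simp)]
      refine ⟨rfl, ?_⟩
      rw [List.count_append, List.count_append, List.count_eq_zero.2 hcx, List.count_eq_zero.2 hcy] at h2
      omega
    · rw [List.filter_append, List.filter_append, filter_ne_self hcx, filter_ne_self hcy]
      congr 1
      · congr 1
        rw [List.append_assoc, List.take_left' hx]
      · rw [List.drop_left']
        simp; omega

lemma prefix_le {c : ℤ} {x t p q : List ℤ} (hc : c ∉ x) (h : x ++ t = p ++ c :: q) :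
    x.length ≤ p.length := by
  by_contra hlt
  push Not at hlt
  apply hc
  have h1 : (x ++ t)[p.length]? = some c := by rw [h]; simp
  rw [List.getElem?_append_left hlt] at h1
  exact List.mem_of_getElem? h1

lemma good_LL (a b s : ℤ → ℕ) (cs : List ℤ) (hn : cs.Nodup) :
    ∀ v ∈ LL a b s cs, (∀ d ∈ cs, v.count d = s d) ∧
      ∀ p d q, v = p ++ d :: q → a d ≤ p.length ∧ b d ≤ q.length := by
  induction cs with
  | nil => simp [LL]
  | cons c cs ih =>
    intro v hv
    rw [List.nodup_cons] at hn
    have hlet := letters_LL a b s _ v hv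
    rw [mem_LL_cons _ _ _ _ _ hn.1] at hv
    obtain ⟨h1, h2, x, u, y, e, hx, hy, hcx, hcy⟩ := hv
    obtain ⟨i1, i2⟩ := ih hn.2 _ h1
    constructor
    · intro d hdm
      rw [List.mem_cons] at hdm
      by_cases hdc : d = c
      · rw [hdc, h2]
      · have := i1 d (hdm.resolve_left hdc)
        rw [List.count_filter (by simpa using hdc)] at this
        exact this
    · intro p d q hpq
      have hdm : d ∈ c :: cs := hlet d (by rw [hpq]; simp)
      rw [List.mem_cons] at hdm
      by_cases hdc : d = c
      · subst hdc
        constructor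
        · rw [← hx]
          refine prefix_le hcx (t := u ++ y) (q := q) ?_
          rw [← hpq, e, List.append_assoc]
        · rw [← hy]
          have := prefix_le (c := d) (x := y.reverse) (t := u.reverse ++ x.reverse)
            (p := q.reverse) (q := p.reverse) (by simpa using hcy) (by
              have := congrArg List.reverse (e.symm.trans hpq)
              simpa using this)
          simpa using this
      · have := i2 (p.filter (· ≠ c)) d (q.filter (· ≠ c)) (by
          rw [hpq, List.filter_append, List.filter_cons]; simp [hdc])
        exact ⟨this.1.trans (List.length_filter_le _ _), this.2.trans (List.length_filter_le _ _)⟩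

/-! ### Sorted lists of cells -/

def Srt (l : List Cell) : Prop := l.Pairwise (fun x y => x.1 < y.1)

def IsF (M : Finset Cell) : Prop := ∀ x ∈ M, ∀ y ∈ M, x.1 = y.1 → x = y

lemma exists_srt (M : Finset Cell) (hM : IsF M) : ∃ l : List Cell, Srt l ∧ l.toFinset = M := by
  induction M using Finset.induction_on_max_value (fun x : Cell => x.1) with
  | empty => exact ⟨[], List.Pairwise.nil, rfl⟩
  | insert a N haN hmax ih =>
    obtain ⟨l, h1, h2⟩ := ih (fun x hx y hy => hM x (by simp [hx]) y (by simp [hy]))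
    refine ⟨l ++ [a], ?_, ?_⟩
    · rw [Srt, List.pairwise_append]
      refine ⟨h1, by simp, ?_⟩
      intro x hx y hy
      simp at hy; subst hy
      have hxN : x ∈ N := by rw [← h2]; simpa using hx
      refine lt_of_le_of_ne (hmax x hxN) fun e => haN ?_
      have := hM x (by simp [hxN]) y (by simp) e
      rwa [← this]
    · rw [List.toFinset_append, h2]; ext; simp [or_comm]

lemma Srt.nodup {l : List Cell} (h : Srt l) : l.Nodup :=
  List.Pairwise.imp (fun {a b} hab e => by rw [e] at hab; exact lt_irrefl _ hab) h

lemma desR_insert (x z : Cell) (N : Finset Cell) (hz : z ∈ N) (h1 : ∀ y ∈ N, x.1 < y.1)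
    (h2 : ∀ y ∈ N, y ≠ z → z.1 < y.1) :
    desR (insert x N) = (if z.2 < x.2 then 1 else 0) + desR N := by
  classical
  have hzle : ∀ y ∈ N, z.1 ≤ y.1 := by
    intro y hy
    by_cases e : y = z
    · rw [e]
    · exact (h2 y hy e).le
  have hxz := h1 z hz
  have key : ∀ p : Cell × Cell, (p ∈ (insert x N) ×ˢ (insert x N) ∧ p.1.1 < p.2.1 ∧ p.2.2 < p.1.2 ∧
      ∀ w ∈ insert x N, ¬ (p.1.1 < w.1 ∧ w.1 < p.2.1)) ↔
      ((p = (x, z) ∧ z.2 < x.2) ∨ (p ∈ N ×ˢ N ∧ p.1.1 < p.2.1 ∧ p.2.2 < p.1.2 ∧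
      ∀ w ∈ N, ¬ (p.1.1 < w.1 ∧ w.1 < p.2.1))) := by
    rintro ⟨p, q⟩
    simp only [Finset.mem_product, Finset.mem_insert, Prod.mk.injEq]
    constructor
    · rintro ⟨⟨hp, hq⟩, h3, h4, h5⟩
      have hqN : q ∈ N := by
        rcases hq with rfl | hq
        · rcases hp with rfl | hp
          · exact absurd h3 (lt_irrefl _)
          · have := h1 p hp; omega
        · exact hq
      rcases hp with rfl | hp
      · left
        have : q = z := by
          by_contra e
          exact h5 z (Or.inr hz) ⟨hxz, h2 q hqN e⟩
        subst this
        exact ⟨⟨rfl, rfl⟩, h4⟩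
      · right
        exact ⟨⟨hp, hqN⟩, h3, h4, fun w hw => h5 w (Or.inr hw)⟩
    · rintro (⟨⟨rfl, rfl⟩, h⟩ | ⟨⟨hp, hq⟩, h3, h4, h5⟩)
      · refine ⟨⟨Or.inl rfl, Or.inr hz⟩, hxz, h, ?_⟩
        rintro w (rfl | hw) ⟨h6, h7⟩
        · exact lt_irrefl _ h6
        · have := hzle w hw; omega
      · refine ⟨⟨Or.inr hp, Or.inr hq⟩, h3, h4, ?_⟩
        rintro w (rfl | hw)
        · have := h1 p hp; omega
        · exact h5 w hw
  unfold desR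
  by_cases hlt : z.2 < x.2
  · rw [if_pos hlt, add_comm, ← Finset.card_insert_of_notMem (a := (x, z))]
    · congr 1; ext p
      rw [Finset.mem_insert, Finset.mem_filter, Finset.mem_filter, key p]; simp [hlt]
    · intro h
      have := h1 x (by simp at h; exact h.1.1)
      exact lt_irrefl _ this
  · rw [if_neg hlt, zero_add]
    congr 1; ext p
    rw [Finset.mem_filter, Finset.mem_filter, key p]; simp [hlt]

lemma desR_singleton (x : Cell) : desR {x} = 0 := by
  simp [desR]

lemma majR_insert (x z : Cell) (N : Finset Cell) (hz : z ∈ N) (h1 : ∀ y ∈ N, x.1 < y.1)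
    (h2 : ∀ y ∈ N, y ≠ z → z.1 < y.1) :
    majR (insert x N) = (if z.2 < x.2 then N.card else 0) + majR N := by
  have hx : x ∉ N := fun h => lt_irrefl _ (h1 x h)
  unfold majR
  rw [Finset.sum_insert hx]
  have e1 : (insert x N).filter (fun y => y.1 ≤ x.1) = {x} := by
    ext y; simp only [Finset.mem_filter, Finset.mem_insert, Finset.mem_singleton]
    constructor
    · rintro ⟨rfl | h, h'⟩
      · rfl
      · have := h1 y h; omega
    · rintro rfl; simp
  rw [e1, desR_singleton, zero_add]
  have e2 : ∀ y ∈ N, desR ((insert x N).filter (fun w => w.1 ≤ y.1)) =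
      (if z.2 < x.2 then 1 else 0) + desR (N.filter (fun w => w.1 ≤ y.1)) := by
    intro y hy
    have : (insert x N).filter (fun w => w.1 ≤ y.1) = insert x (N.filter (fun w => w.1 ≤ y.1)) := by
      rw [Finset.filter_insert, if_pos (h1 y hy).le]
    rw [this]
    apply desR_insert
    · rw [Finset.mem_filter]
      refine ⟨hz, ?_⟩
      by_cases e : y = z
      · rw [e]
      · exact (h2 y hy e).le
    · intro w hw; exact h1 w (Finset.mem_filter.1 hw).1
    · intro w hw; exact h2 w (Finset.mem_filter.1 hw).1
  rw [Finset.sum_congr rfl e2, Finset.sum_add_distrib]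
  congr 1
  simp

lemma majR_list (l : List Cell) (h : Srt l) : majR l.toFinset = majL (l.map Prod.snd) := by
  induction l with
  | nil => simp [majR, majL]
  | cons x l ih =>
    rw [Srt, List.pairwise_cons] at h
    cases l with
    | nil => simp [majR, majL, Finset.filter_singleton, desR_singleton]
    | cons z t =>
      have ht := (List.pairwise_cons.1 h.2).1
      rw [List.toFinset_cons, majR_insert x z _ (by simp) (by simpa using h.1), ih h.2,
        List.toFinset_card_of_nodup (Srt.nodup h.2)]
      · simp [majL]
      · intro y hy hne
        simp at hy
        exact ht y (by simpa using hy.resolve_left hne)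

lemma majR_mono {M N : Finset Cell} (hN : IsF N) (h : M ⊆ N) : majR M ≤ majR N := by
  obtain ⟨l, h1, rfl⟩ := exists_srt N hN
  have : M = (l.filter (fun x => x ∈ M)).toFinset := by
    ext x; simp; intro hx; simpa using h hx
  rw [this, majR_list _ h1, majR_list _ (List.Pairwise.filter _ h1)]
  exact majL_sublist (List.filter_sublist.map _)

open scoped Classical in
lemma pair_list (Q : ℤ → ℤ → Bool) (l : List Cell) (h : Srt l) :
    ((l.toFinset ×ˢ l.toFinset).filter fun p => p.2.1 < p.1.1 ∧ Q p.2.2 p.1.2 = true).card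
      = pairL Q (l.map Prod.snd) := by
  induction l with
  | nil => simp [pairL]
  | cons x l ih =>
    have hnd := Srt.nodup h
    rw [Srt, List.pairwise_cons] at h
    rw [List.map_cons, pairL, ← ih h.2]
    have e : List.countP (Q x.2) (l.map Prod.snd) =
        ((l.toFinset.filter (fun y => Q x.2 y.2 = true)).image (fun y => (y, x))).card := by
      rw [Finset.card_image_of_injective _ (fun a b hab => by simpa using hab), List.countP_map,
        List.countP_eq_length_filter, ← List.toFinset_card_of_nodup ((List.nodup_cons.1 hnd).2.filter _)]
      congr 1; ext y; simp
    rw [e, ← Finset.card_union_of_disjoint]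
    · congr 1
      ext ⟨p, q⟩
      simp only [Finset.mem_filter, Finset.mem_product, Finset.mem_union, Finset.mem_image,
        List.mem_toFinset, List.mem_cons, Prod.mk.injEq]
      constructor
      · rintro ⟨⟨hp, hq⟩, h3, h4⟩
        have hpl : p ∈ l := by
          rcases hp with rfl | hp
          · rcases hq with rfl | hq
            · exact absurd h3 (lt_irrefl _)
            · have := h.1 q hq; omega
          · exact hp
        rcases hq with rfl | hq
        · left; exact ⟨p, ⟨hpl, h4⟩, rfl, rfl⟩
        · right; exact ⟨⟨hpl, hq⟩, h3, h4⟩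
      · rintro (⟨y, ⟨hy, h3⟩, rfl, rfl⟩ | ⟨⟨hp, hq⟩, h3, h4⟩)
        · exact ⟨⟨Or.inr hy, Or.inl rfl⟩, h.1 y hy, h3⟩
        · exact ⟨⟨Or.inr hp, Or.inr hq⟩, h3, h4⟩
    · rw [Finset.disjoint_left]
      rintro ⟨p, q⟩ h1 h2
      simp only [Finset.mem_filter, Finset.mem_product, Finset.mem_image,
        List.mem_toFinset, Prod.mk.injEq] at h1 h2
      obtain ⟨y, -, -, rfl⟩ := h1
      exact (List.nodup_cons.1 hnd).1 h2.1.2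

/-! ### Geometry of moon polyominoes -/

def del (P : Finset Cell) (c : ℤ) : Finset Cell := P.filter (fun x => x.2 ≠ c)

def rin (P : Finset Cell) (c : ℤ) (M : Finset Cell) : Finset Cell :=
  M.filter (fun x => (x.1, c) ∈ P)

structure Step (P : Finset Cell) (c : ℤ) : Prop where
  moon : IsMoon P
  mem : c ∈ colSet P
  le : ∀ d ∈ colSet P, ∀ r, (r, c) ∈ P → (r, d) ∈ P
  ext : (∀ d ∈ colSet P, c ≤ d) ∨ (∀ d ∈ colSet P, d ≤ c)

lemma mem_del {P : Finset Cell} {c r d : ℤ} : (r, d) ∈ del P c ↔ (r, d) ∈ P ∧ d ≠ c := by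
  simp [del]

lemma mem_colSet {P : Finset Cell} {d : ℤ} : d ∈ colSet P ↔ ∃ r, (r, d) ∈ P := by
  simp [colSet]

lemma colSet_del (P : Finset Cell) (c : ℤ) : colSet (del P c) = (colSet P).erase c := by
  ext d; simp only [mem_colSet, Finset.mem_erase, mem_del]; tauto

lemma mem_rowSet {P : Finset Cell} {r : ℤ} : r ∈ rowSet P ↔ ∃ d, (r, d) ∈ P := by
  simp [rowSet]

lemma moon_del {P : Finset Cell} {c : ℤ} (h : Step P c) : IsMoon (del P c) := by
  obtain ⟨⟨h1, h2, h3⟩, hc, hle, hext⟩ := h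
  refine ⟨?_, ?_, ?_⟩
  · intro r d e f hd he h4 h5
    rw [mem_del] at *
    refine ⟨h1 r d e f hd.1 he.1 h4 h5, ?_⟩
    have d1 := mem_colSet.2 ⟨_, hd.1⟩
    have e1 := mem_colSet.2 ⟨_, he.1⟩
    rcases hext with h | h
    · have := h d d1; have := hd.2; omega
    · have := h e e1; have := he.2; omega
  · intro d r r' r'' hr hr' h4 h5
    rw [mem_del] at *
    exact ⟨h2 d r r' r'' hr.1 hr'.1 h4 h5, hr.2⟩
  · intro d e
    by_cases hd : d = c
    · left; intro r hr; rw [mem_del] at hr; exact absurd hd hr.2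
    by_cases he : e = c
    · right; intro r hr; rw [mem_del] at hr; exact absurd he hr.2
    rcases h3 d e with h | h
    · left; intro r hr; rw [mem_del] at *; exact ⟨h r hr.1, he⟩
    · right; intro r hr; rw [mem_del] at *; exact ⟨h r hr.1, hd⟩

open scoped Classical in
lemma ne_step {P : Finset Cell} {c : ℤ} (h : Step P c) {M : Finset Cell} (hM : M ⊆ P) :
    neP P M = ((rin P c M ×ˢ rin P c M).filter
      fun p => p.2.1 < p.1.1 ∧ Qc c p.2.2 p.1.2 = true).card + neP (del P c) (del M c) := by
  obtain ⟨⟨h1, h2, h3⟩, hc, hle, hext⟩ := h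
  have hcol : ∀ x ∈ M, x.2 ∈ colSet P := fun x hx => mem_colSet.2 ⟨x.1, hM hx⟩
  unfold neP
  rw [← Finset.card_filter_add_card_filter_not (fun p : Cell × Cell => p.1.2 = c ∨ p.2.2 = c)]
  congr 1
  · congr 1
    ext ⟨p, q⟩
    simp only [Finset.mem_filter, Finset.mem_product, rin, Qc, decide_eq_true_eq]
    constructor
    · rintro ⟨⟨⟨hp, hq⟩, h4, h5, h6⟩, h7⟩
      have ha : (p.1, c) ∈ P ∧ (q.1, c) ∈ P := by
        rcases h7 with h7 | h7
        · exact ⟨h6 _ _ h4.le le_rfl h7.le (by omega), h6 _ _ le_rfl h4.le h7.le (by omega)⟩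
        · exact ⟨h6 _ _ h4.le le_rfl (by omega) h7.ge, h6 _ _ le_rfl h4.le (by omega) h7.ge⟩
      exact ⟨⟨⟨hp, ha.1⟩, hq, ha.2⟩, h4, h5, h7.symm⟩
    · rintro ⟨⟨⟨hp, hp'⟩, hq, hq'⟩, h4, h5, h7⟩
      refine ⟨⟨⟨hp, hq⟩, h4, h5, ?_⟩, h7.symm⟩
      intro r d r1 r2 d1 d2
      have hr : (r, c) ∈ P := h2 c q.1 p.1 r hq' hp' r1 r2
      exact h1 r p.2 q.2 d (hle _ (hcol p hp) r hr) (hle _ (hcol q hq) r hr) d1 d2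
  · congr 1
    ext ⟨p, q⟩
    simp only [Finset.mem_filter, Finset.mem_product, del, not_or]
    constructor
    · rintro ⟨⟨⟨hp, hq⟩, h4, h5, h6⟩, h7, h8⟩
      refine ⟨⟨⟨hp, h7⟩, hq, h8⟩, h4, h5, ?_⟩
      intro r d r1 r2 d1 d2
      refine ⟨h6 r d r1 r2 d1 d2, ?_⟩
      rcases hext with h | h
      · have := h _ (hcol p hp); omega
      · have := h _ (hcol q hq); omega
    · rintro ⟨⟨⟨hp, h7⟩, hq, h8⟩, h4, h5, h6⟩
      exact ⟨⟨⟨hp, hq⟩, h4, h5, fun r d r1 r2 d1 d2 => (h6 r d r1 r2 d1 d2).1⟩, h7, h8⟩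

open scoped Classical in
noncomputable def RR (P : Finset Cell) (d : ℤ) : Finset Cell :=
  P.filter (fun x => (x.1, d) ∈ P ∧ ∀ r, (r, d) ∈ P → (r, x.2) ∈ P)

lemma mem_RR {P : Finset Cell} {d : ℤ} {x : Cell} :
    x ∈ RR P d ↔ x ∈ P ∧ (x.1, d) ∈ P ∧ ∀ r, (r, d) ∈ P → (r, x.2) ∈ P := by
  simp [RR]

lemma exists_Icc (S : Finset ℤ) (hS : S.Nonempty)
    (h : ∀ x ∈ S, ∀ y ∈ S, ∀ z, x ≤ z → z ≤ y → z ∈ S) : ∃ a b, a ≤ b ∧ S = Finset.Icc a b := by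
  refine ⟨S.min' hS, S.max' hS, Finset.min'_le _ _ (Finset.max'_mem _ _), ?_⟩
  ext z
  rw [Finset.mem_Icc]
  constructor
  · intro hz; exact ⟨Finset.min'_le _ _ hz, Finset.le_max' _ _ hz⟩
  · rintro ⟨h1, h2⟩; exact h _ (Finset.min'_mem _ _) _ (Finset.max'_mem _ _) _ h1 h2

lemma isMaxRect_RR {P : Finset Cell} (hP : IsMoon P) {d : ℤ} (hd : d ∈ colSet P) :
    IsMaxRect P (RR P d) := by
  classical
  obtain ⟨h1, h2, h3⟩ := hP
  obtain ⟨r0, hr0⟩ := mem_colSet.1 hd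
  refine ⟨?_, ?_, ?_⟩
  · obtain ⟨a, b, hab, e1⟩ := exists_Icc ((rowSet P).filter (fun r => (r, d) ∈ P))
      ⟨r0, by simp [hr0, mem_rowSet]; exact ⟨d, hr0⟩⟩ (by
        intro x hx y hy z h4 h5
        simp only [Finset.mem_filter, mem_rowSet] at *
        have := h2 d x y z hx.2 hy.2 h4 h5
        exact ⟨⟨_, this⟩, this⟩)
    obtain ⟨a', b', hab', e2⟩ := exists_Icc ((colSet P).filter (fun e => ∀ r, (r, d) ∈ P → (r, e) ∈ P))
      ⟨d, by simp [hd]⟩ (by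
        intro x hx y hy z h4 h5
        simp only [Finset.mem_filter, mem_colSet] at *
        have := fun r hr => h1 r x y z (hx.2 r hr) (hy.2 r hr) h4 h5
        exact ⟨⟨r0, this r0 hr0⟩, this⟩)
    refine ⟨a, b, a', b', hab, hab', ?_⟩
    rw [← e1, ← e2]
    ext ⟨r, e⟩
    simp only [mem_RR, Finset.mem_product, Finset.mem_filter, mem_rowSet, mem_colSet]
    constructor
    · rintro ⟨h4, h5, h6⟩; exact ⟨⟨⟨_, h4⟩, h5⟩, ⟨_, h4⟩, h6⟩
    · rintro ⟨⟨-, h5⟩, -, h6⟩; exact ⟨h6 r h5, h5, h6⟩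
  · intro x hx; exact (mem_RR.1 hx).1
  · rintro R' ⟨a, b, a', b', hab, hab', rfl⟩ hsub hle
    apply Finset.Subset.antisymm _ hle
    have hdR : ∀ r, (r, d) ∈ P → (r, d) ∈ Finset.Icc a b ×ˢ Finset.Icc a' b' := fun r hr =>
      hle (mem_RR.2 ⟨hr, hr, fun _ h => h⟩)
    rintro ⟨r, e⟩ hx
    have hd0 := hdR r0 hr0
    rw [Finset.mem_product] at hx hd0
    refine mem_RR.2 ⟨hsub (Finset.mem_product.2 hx), hsub (Finset.mem_product.2 ⟨hx.1, hd0.2⟩), ?_⟩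
    intro r' hr'
    exact hsub (Finset.mem_product.2 ⟨(Finset.mem_product.1 (hdR r' hr')).1, hx.2⟩)

/-- a minimal column in a nonempty set of columns -/
lemma exists_min_col {P : Finset Cell} (hP : IsMoon P) (S : Finset ℤ) (hS : S.Nonempty) :
    ∃ d ∈ S, ∀ e ∈ S, ∀ r, (r, d) ∈ P → (r, e) ∈ P := by
  induction hS using Finset.Nonempty.cons_induction with
  | singleton a => exact ⟨a, by simp⟩
  | cons a s ha hs ih =>
    obtain ⟨d, hd, h⟩ := ih
    rcases hP.2.2 a d with h' | h'
    · refine ⟨a, by simp, ?_⟩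
      intro e he r hr
      rw [Finset.mem_cons] at he
      rcases he with rfl | he
      · exact hr
      · exact h e he r (h' r hr)
    · refine ⟨d, by simp [hd], ?_⟩
      intro e he r hr
      rw [Finset.mem_cons] at he
      rcases he with rfl | he
      · exact h' r hr
      · exact h e he r hr

lemma mem_maxRects {P : Finset Cell} (hP : IsMoon P) {R : Finset Cell} :
    R ∈ maxRects P ↔ ∃ d ∈ colSet P, R = RR P d := by
  simp only [maxRects, Finset.mem_filter, Finset.mem_powerset]
  constructor
  · rintro ⟨hsub, ⟨a, b, a', b', hab, hab', rfl⟩, -, hmax⟩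
    obtain ⟨d, hd, hmin⟩ := exists_min_col hP (Finset.Icc a' b') ⟨a', by simp [hab']⟩
    have hdc : d ∈ colSet P :=
      mem_colSet.2 ⟨a, hsub (by simp only [Finset.mem_product]; exact ⟨by simp [hab], hd⟩)⟩
    refine ⟨d, hdc, ?_⟩
    have hm := isMaxRect_RR hP hdc
    refine (hmax _ hm.1 hm.2.1 ?_).symm
    rintro ⟨r, e⟩ hx
    have hx' := Finset.mem_product.1 hx
    exact mem_RR.2 ⟨hsub hx, hsub (Finset.mem_product.2 ⟨hx'.1, hd⟩), hmin e hx'.2⟩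
  · rintro ⟨d, hd, rfl⟩
    have := isMaxRect_RR hP hd
    exact ⟨this.2.1, this⟩

lemma rows_RR {P : Finset Cell} (d : ℤ) :
    (RR P d).image Prod.fst = (P.filter (fun x => x.2 = d)).image Prod.fst := by
  ext r
  simp only [Finset.mem_image, mem_RR, Finset.mem_filter]
  constructor
  · rintro ⟨x, ⟨h1, h2, h3⟩, rfl⟩; exact ⟨(x.1, d), ⟨h2, rfl⟩, rfl⟩
  · rintro ⟨x, ⟨h1, rfl⟩, rfl⟩; exact ⟨x, ⟨h1, h1, fun _ h => h⟩, rfl⟩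

lemma mem_rows_col {P : Finset Cell} {d r : ℤ} :
    r ∈ (P.filter (fun x => x.2 = d)).image Prod.fst ↔ (r, d) ∈ P := by
  simp

lemma nRows_le {P : Finset Cell} {d e : ℤ} (h : ∀ r, (r, d) ∈ P → (r, e) ∈ P) :
    nRows (RR P d) ≤ nRows (RR P e) := by
  unfold nRows
  rw [rows_RR, rows_RR]
  apply Finset.card_le_card
  intro r; rw [mem_rows_col, mem_rows_col]; exact h r

lemma nRows_lt {P : Finset Cell} {d e : ℤ} (h : ∀ r, (r, d) ∈ P → (r, e) ∈ P)
    (h' : ¬ ∀ r, (r, e) ∈ P → (r, d) ∈ P) :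
    nRows (RR P d) < nRows (RR P e) := by
  unfold nRows
  rw [rows_RR, rows_RR]
  apply Finset.card_lt_card
  rw [Finset.ssubset_def]
  constructor
  · intro r; rw [mem_rows_col, mem_rows_col]; exact h r
  · intro hs; apply h'; intro r hr
    exact mem_rows_col.1 (hs (mem_rows_col.2 hr))

lemma RR_eq {P : Finset Cell} {d e : ℤ} (h : ∀ r, (r, d) ∈ P → (r, e) ∈ P)
    (h' : ∀ r, (r, e) ∈ P → (r, d) ∈ P) : RR P d = RR P e := by
  ext x; rw [mem_RR, mem_RR]
  constructor
  · rintro ⟨h1, h2, h3⟩; exact ⟨h1, h _ h2, fun r hr => h3 r (h' r hr)⟩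
  · rintro ⟨h1, h2, h3⟩; exact ⟨h1, h' _ h2, fun r hr => h3 r (h r hr)⟩

open scoped Classical in
noncomputable def consec (S : Finset (Finset Cell)) : Finset (Finset Cell × Finset Cell) :=
  (S ×ˢ S).filter (fun p => nRows p.1 < nRows p.2 ∧
          ∀ T ∈ S, ¬ (nRows p.1 < nRows T ∧ nRows T < nRows p.2))

noncomputable def mz (S : Finset (Finset Cell)) (M : Finset Cell) : ℤ :=
  (∑ R ∈ S, (majR (M ∩ R) : ℤ)) - ∑ p ∈ consec S, (majR (M ∩ p.1 ∩ p.2) : ℤ)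

lemma majP_eq (P M : Finset Cell) : majP P M = (mz (maxRects P) M).toNat := by
  rw [majP, mz, ← Int.toNat_sub]
  push_cast; rfl

open scoped Classical in
lemma mz_insert (S : Finset (Finset Cell)) (R M : Finset Cell) (h : ∀ T ∈ S, nRows R < nRows T) :
    mz (insert R S) M = mz S M + majR (M ∩ R)
      - ∑ T ∈ S.filter (fun T => ∀ U ∈ S, nRows T ≤ nRows U), (majR (M ∩ R ∩ T) : ℤ) := by
  have hR : R ∉ S := fun hh => lt_irrefl _ (h R hh)
  have e : consec (insert R S) = consec S ∪
      (S.filter (fun T => ∀ U ∈ S, nRows T ≤ nRows U)).image (fun T => (R, T)) := by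
    ext ⟨p, q⟩
    simp only [consec, Finset.mem_filter, Finset.mem_product, Finset.mem_insert, Finset.mem_union,
      Finset.mem_image, Prod.mk.injEq]
    constructor
    · rintro ⟨⟨hp, hq⟩, h1, h2⟩
      have hqS : q ∈ S := by
        rcases hq with rfl | hq
        · rcases hp with rfl | hp
          · exact absurd h1 (lt_irrefl _)
          · have := h p hp; omega
        · exact hq
      rcases hp with rfl | hp
      · right
        refine ⟨q, ⟨hqS, ?_⟩, rfl, rfl⟩
        intro U hU
        by_contra hlt
        exact h2 U (Or.inr hU) ⟨h U hU, by omega⟩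
      · left
        exact ⟨⟨hp, hqS⟩, h1, fun T hT => h2 T (Or.inr hT)⟩
    · rintro (⟨⟨hp, hq⟩, h1, h2⟩ | ⟨T, ⟨hT, hT2⟩, rfl, rfl⟩)
      · refine ⟨⟨Or.inr hp, Or.inr hq⟩, h1, ?_⟩
        rintro T (rfl | hT)
        · have := h p hp; omega
        · exact h2 T hT
      · refine ⟨⟨Or.inl rfl, Or.inr hT⟩, h T hT, ?_⟩
        rintro U (rfl | hU)
        · simp
        · have := hT2 U hU; omega
  rw [mz, mz, e, Finset.sum_insert hR, Finset.sum_union, Finset.sum_image]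
  · ring
  · intro a _ b _ hab; simpa using hab
  · rw [Finset.disjoint_left]
    rintro ⟨p, q⟩ h1 h2
    simp only [consec, Finset.mem_filter, Finset.mem_product,
      Finset.mem_image, Prod.mk.injEq] at h1 h2
    obtain ⟨y, -, rfl, -⟩ := h2
    exact hR h1.1.1

lemma majR_empty : majR ∅ = 0 := by simp [majR]

lemma mz_congr (S : Finset (Finset Cell)) (M N : Finset Cell) (h : ∀ T ∈ S, M ∩ T = N ∩ T) :
    mz S M = mz S N := by
  unfold mz
  congr 1
  · exact Finset.sum_congr rfl fun R hR => by rw [h R hR]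
  · refine Finset.sum_congr rfl fun p hp => ?_
    simp only [consec, Finset.mem_filter, Finset.mem_product] at hp
    rw [h p.1 hp.1.1]

lemma maj_step {P : Finset Cell} {c : ℤ} (h : Step P c) {M : Finset Cell} (hM : M ⊆ P) :
    mz (maxRects P) M = mz (maxRects (del P c)) (del M c)
      + majR (rin P c M) - majR (rin P c (del M c)) := by
  classical
  have hmoon' := moon_del h
  obtain ⟨hP, hc, hle, hext⟩ := h
  have hcol : ∀ x ∈ M, x.2 ∈ colSet P := fun x hx => mem_colSet.2 ⟨x.1, hM hx⟩
  set 𝓣 := ((colSet P).filter (fun d => ¬ ∀ r, (r, d) ∈ P → (r, c) ∈ P)).image (RR P) with h𝓣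
  have mT : ∀ T, T ∈ 𝓣 ↔ ∃ d ∈ colSet P, (¬ ∀ r, (r, d) ∈ P → (r, c) ∈ P) ∧ RR P d = T := by
    intro T; rw [h𝓣]; simp only [Finset.mem_image, Finset.mem_filter, and_assoc]
  have E0 : maxRects P = insert (RR P c) 𝓣 := by
    ext R
    rw [mem_maxRects hP, Finset.mem_insert, mT]
    constructor
    · rintro ⟨d, hd, rfl⟩
      by_cases hdc : ∀ r, (r, d) ∈ P → (r, c) ∈ P
      · left; exact RR_eq hdc (hle d hd)
      · right; exact ⟨d, hd, hdc, rfl⟩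
    · rintro (rfl | ⟨d, hd, -, rfl⟩)
      · exact ⟨c, hc, rfl⟩
      · exact ⟨d, hd, rfl⟩
  have hlt : ∀ T ∈ 𝓣, nRows (RR P c) < nRows T := by
    intro T hT
    obtain ⟨d, hd, hdc, rfl⟩ := (mT T).1 hT
    exact nRows_lt (hle d hd) hdc
  have hcT : ∀ T ∈ 𝓣, ∀ x ∈ T, x.2 ≠ c := by
    intro T hT x hx e
    obtain ⟨d, hd, hdc, rfl⟩ := (mT T).1 hT
    rw [mem_RR, e] at hx
    exact hdc hx.2.2
  have E1 : ∀ T ∈ 𝓣, M ∩ T = del M c ∩ T := by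
    intro T hT
    ext x
    simp only [Finset.mem_inter, del, Finset.mem_filter]
    exact ⟨fun hx => ⟨⟨hx.1, hcT T hT x hx.2⟩, hx.2⟩, fun hx => ⟨hx.1.1, hx.2⟩⟩
  have E2 : ∀ d, (¬ ∀ r, (r, d) ∈ P → (r, c) ∈ P) → RR (del P c) d = RR P d := by
    intro d hdc
    have hd : d ≠ c := by rintro rfl; exact hdc fun _ h => h
    ext ⟨r, e⟩
    simp only [mem_RR, mem_del]
    constructor
    · rintro ⟨h1, h2, h3⟩
      exact ⟨h1.1, h2.1, fun r hr => (h3 r ⟨hr, hd⟩).1⟩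
    · rintro ⟨h1, h2, h3⟩
      have he : e ≠ c := by rintro rfl; exact hdc h3
      exact ⟨⟨h1, he⟩, ⟨h2, hd⟩, fun r hr => ⟨h3 r hr.1, he⟩⟩
  have E3 : M ∩ RR P c = rin P c M := by
    ext x
    simp only [Finset.mem_inter, mem_RR, rin, Finset.mem_filter]
    exact ⟨fun hx => ⟨hx.1, hx.2.2.1⟩, fun hx => ⟨hx.1, hM hx.1, hx.2, hle _ (hcol x hx.1)⟩⟩
  rw [E0, mz_insert _ _ _ hlt, E3, mz_congr 𝓣 M (del M c) E1]
  by_cases hA : ∃ d ∈ colSet (del P c), ∀ r, (r, d) ∈ P → (r, c) ∈ P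
  · obtain ⟨d0, hd0, hd0c⟩ := hA
    have hd0' := hd0
    rw [colSet_del, Finset.mem_erase] at hd0'
    have E4 : maxRects (del P c) = insert (RR (del P c) d0) 𝓣 := by
      ext R
      rw [mem_maxRects hmoon', Finset.mem_insert, mT]
      constructor
      · rintro ⟨d, hd, rfl⟩
        rw [colSet_del, Finset.mem_erase] at hd
        by_cases hdc : ∀ r, (r, d) ∈ P → (r, c) ∈ P
        · left
          apply RR_eq
          · intro r hr
            rw [mem_del] at *
            exact ⟨hle _ hd0'.2 r (hdc r hr.1), hd0'.1⟩
          · intro r hr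
            rw [mem_del] at *
            exact ⟨hle _ hd.2 r (hd0c r hr.1), hd.1⟩
        · right; exact ⟨d, hd.2, hdc, (E2 d hdc).symm⟩
      · rintro (rfl | ⟨d, hd, hdc, rfl⟩)
        · exact ⟨d0, hd0, rfl⟩
        · refine ⟨d, ?_, (E2 d hdc).symm⟩
          rw [colSet_del, Finset.mem_erase]
          refine ⟨?_, hd⟩
          rintro rfl; exact hdc fun _ h => h
    have hlt' : ∀ T ∈ 𝓣, nRows (RR (del P c) d0) < nRows T := by
      intro T hT
      obtain ⟨d, hd, hdc, rfl⟩ := (mT T).1 hT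
      have hne : d ≠ c := by rintro rfl; exact hdc fun _ h => h
      rw [← E2 d hdc]
      apply nRows_lt
      · intro r hr
        rw [mem_del] at *
        exact ⟨hle _ hd r (hd0c r hr.1), hne⟩
      · intro hh
        apply hdc
        intro r hr
        exact hd0c r (mem_del.1 (hh r (mem_del.2 ⟨hr, hne⟩))).1
    have E5 : del M c ∩ RR (del P c) d0 = rin P c (del M c) := by
      ext ⟨r, e⟩
      simp only [Finset.mem_inter, mem_RR, rin, Finset.mem_filter, mem_del]
      constructor
      · rintro ⟨h1, h2, h3, h4⟩
        exact ⟨h1, hd0c r h3.1⟩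
      · rintro ⟨h1, h2⟩
        refine ⟨h1, ⟨hM h1.1, h1.2⟩, ⟨hle _ hd0'.2 r h2, hd0'.1⟩, ?_⟩
        intro r' hr'
        exact ⟨hle _ (hcol _ h1.1) r' (hd0c r' hr'.1), h1.2⟩
    rw [E4, mz_insert _ _ _ hlt', E5]
    have E6 : ∀ T ∈ 𝓣, rin P c M ∩ T = rin P c (del M c) ∩ T := by
      intro T hT
      ext x
      simp only [Finset.mem_inter, rin, del, Finset.mem_filter]
      exact ⟨fun hx => ⟨⟨⟨hx.1.1, hcT T hT x hx.2⟩, hx.1.2⟩, hx.2⟩,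
        fun hx => ⟨⟨hx.1.1.1, hx.1.2⟩, hx.2⟩⟩
    rw [Finset.sum_congr rfl (fun T hT => by rw [E6 T (Finset.mem_filter.1 hT).1])]
    ring
  · push Not at hA
    have hA' : ∀ d ∈ colSet (del P c), ¬ ∀ r, (r, d) ∈ P → (r, c) ∈ P := by
      intro d hd hh
      obtain ⟨r, h1, h2⟩ := hA d hd
      exact h2 (hh r h1)
    have E4 : maxRects (del P c) = 𝓣 := by
      ext R
      rw [mem_maxRects hmoon', mT]
      constructor
      · rintro ⟨d, hd, rfl⟩
        have hdc := hA' d hd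
        rw [colSet_del, Finset.mem_erase] at hd
        exact ⟨d, hd.2, hdc, (E2 d hdc).symm⟩
      · rintro ⟨d, hd, hdc, rfl⟩
        refine ⟨d, ?_, (E2 d hdc).symm⟩
        rw [colSet_del, Finset.mem_erase]
        refine ⟨?_, hd⟩
        rintro rfl; exact hdc fun _ h => h
    rw [E4]
    have E7 : ∑ T ∈ 𝓣.filter (fun T => ∀ U ∈ 𝓣, nRows T ≤ nRows U), (majR (rin P c M ∩ T) : ℤ)
        = majR (rin P c (del M c)) := by
      rcases (colSet (del P c)).eq_empty_or_nonempty with he | hne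
      · have h1 : 𝓣 = ∅ := by
          rw [← E4, Finset.eq_empty_iff_forall_notMem]
          intro R hR
          obtain ⟨d, hd, -⟩ := (mem_maxRects hmoon').1 hR
          rw [he] at hd; simp at hd
        have h2 : del M c = ∅ := by
          rw [Finset.eq_empty_iff_forall_notMem]
          rintro ⟨r, e⟩ hx
          rw [mem_del] at hx
          have : e ∈ colSet (del P c) := mem_colSet.2 ⟨r, mem_del.2 ⟨hM hx.1, hx.2⟩⟩
          rw [he] at this; simp at this
        rw [h1, h2]; simp [rin, majR_empty]
      · obtain ⟨d0, hd0, hmin⟩ := exists_min_col hP _ hne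
        have hd0c := hA' d0 hd0
        have hd0' := hd0
        rw [colSet_del, Finset.mem_erase] at hd0'
        have hT0 : RR P d0 ∈ 𝓣 := (mT _).2 ⟨d0, hd0'.2, hd0c, rfl⟩
        have hmin' : ∀ d ∈ colSet P, (¬ ∀ r, (r, d) ∈ P → (r, c) ∈ P) →
            ∀ r, (r, d0) ∈ P → (r, d) ∈ P := by
          intro d hd hdc
          apply hmin
          rw [colSet_del, Finset.mem_erase]
          refine ⟨?_, hd⟩
          rintro rfl; exact hdc fun _ h => h
        have E8 : 𝓣.filter (fun T => ∀ U ∈ 𝓣, nRows T ≤ nRows U) = {RR P d0} := by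
          ext T
          rw [Finset.mem_filter, Finset.mem_singleton]
          constructor
          · rintro ⟨hT, hT2⟩
            obtain ⟨d, hd, hdc, rfl⟩ := (mT T).1 hT
            have h5 := hT2 _ hT0
            have h6 := hmin' d hd hdc
            by_cases h7 : ∀ r, (r, d) ∈ P → (r, d0) ∈ P
            · exact RR_eq h7 h6
            · have := nRows_lt h6 h7; omega
          · rintro rfl
            refine ⟨hT0, ?_⟩
            intro U hU
            obtain ⟨d, hd, hdc, rfl⟩ := (mT U).1 hU
            exact nRows_le (hmin' d hd hdc)
        rw [E8, Finset.sum_singleton]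
        congr 2
        ext ⟨r, e⟩
        simp only [Finset.mem_inter, mem_RR, rin, Finset.mem_filter, mem_del]
        constructor
        · rintro ⟨⟨h1, h2⟩, h3, h4, h5⟩
          refine ⟨⟨h1, ?_⟩, h2⟩
          rintro rfl; exact hd0c h5
        · rintro ⟨⟨h1, h2⟩, h3⟩
          refine ⟨⟨h1, h3⟩, hM h1, hle _ hd0'.2 _ h3, ?_⟩
          apply hmin
          rw [colSet_del, Finset.mem_erase]
          exact ⟨h2, hcol _ h1⟩
    rw [E7]

/-! ### Linking fillings with words -/

def OrdP : Finset Cell → List ℤ → Prop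
  | P, [] => P = ∅
  | P, c :: cs => Step P c ∧ OrdP (del P c) cs

lemma exists_ord : ∀ (n : ℕ) (P : Finset Cell), P.card = n → IsMoon P → ∃ cs, OrdP P cs := by
  intro n
  induction n using Nat.strong_induction_on with
  | _ n ih =>
    intro P hn hP
    rcases P.eq_empty_or_nonempty with h0 | ⟨x0, hx0⟩
    · exact ⟨[], h0⟩
    have hne : (colSet P).Nonempty := ⟨x0.2, mem_colSet.2 ⟨x0.1, hx0⟩⟩
    obtain ⟨c, hc⟩ : ∃ c, Step P c := by
      have hl := Finset.min'_mem _ hne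
      have hu := Finset.max'_mem _ hne
      have hl' : ∀ d ∈ colSet P, (colSet P).min' hne ≤ d := fun d hd => Finset.min'_le _ _ hd
      have hu' : ∀ d ∈ colSet P, d ≤ (colSet P).max' hne := fun d hd => Finset.le_max' _ _ hd
      rcases hP.2.2 ((colSet P).min' hne) ((colSet P).max' hne) with h | h
      · exact ⟨_, hP, hl, fun d hd r hr => hP.1 r _ _ d hr (h r hr) (hl' d hd) (hu' d hd),
          Or.inl hl'⟩
      · exact ⟨_, hP, hu, fun d hd r hr => hP.1 r _ _ d (h r hr) hr (hl' d hd) (hu' d hd),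
          Or.inr hu'⟩
    have hlt : (del P c).card < n := by
      rw [← hn]
      apply Finset.card_lt_card
      rw [Finset.ssubset_iff_of_subset (show del P c ⊆ P from Finset.filter_subset _ _)]
      obtain ⟨r, hr⟩ := mem_colSet.1 hc.mem
      exact ⟨(r, c), hr, by simp [mem_del]⟩
    obtain ⟨cs, hcs⟩ := ih _ hlt (del P c) rfl (moon_del hc)
    exact ⟨c :: cs, hc, hcs⟩

lemma OrdP.mem_iff {cs : List ℤ} : ∀ {P : Finset Cell}, OrdP P cs → ∀ d, d ∈ cs ↔ d ∈ colSet P := by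
  induction cs with
  | nil => intro P h d; rw [OrdP] at h; subst h; simp [colSet]
  | cons c cs ih =>
    intro P h d
    have := ih h.2 d
    rw [List.mem_cons, this, colSet_del, Finset.mem_erase]
    have := h.1.mem
    by_cases hd : d = c
    · subst hd; simp [this]
    · simp [hd]

lemma OrdP.nodup {cs : List ℤ} : ∀ {P : Finset Cell}, OrdP P cs → cs.Nodup := by
  induction cs with
  | nil => intro P h; simp
  | cons c cs ih =>
    intro P h
    rw [List.nodup_cons]
    refine ⟨?_, ih h.2⟩
    rw [h.2.mem_iff, colSet_del]; simp

lemma OrdP.ext {cs : List ℤ} : ∀ {P : Finset Cell}, OrdP P cs → Ext cs := by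
  induction cs with
  | nil => intro P h; trivial
  | cons c cs ih =>
    intro P h
    refine ⟨?_, ih h.2⟩
    have key : ∀ d ∈ cs, d ≠ c ∧ d ∈ colSet P := by
      intro d hd
      rw [h.2.mem_iff, colSet_del, Finset.mem_erase] at hd
      exact hd
    rcases h.1.ext with h' | h'
    · left; intro d hd
      exact lt_of_le_of_ne (h' d (key d hd).2) (key d hd).1.symm
    · right; intro d hd
      exact lt_of_le_of_ne (h' d (key d hd).2) (key d hd).1

def Ab (P : Finset Cell) (d r : ℤ) : Prop := ∀ r', (r', d) ∈ P → r < r'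
def Bl (P : Finset Cell) (d r : ℤ) : Prop := ∀ r', (r', d) ∈ P → r' < r

lemma tri {P : Finset Cell} (hP : ColConvex P) {d r : ℤ} (h1 : ¬ Ab P d r) (h2 : ¬ Bl P d r) :
    (r, d) ∈ P := by
  unfold Ab at h1; unfold Bl at h2
  push Not at h1 h2
  obtain ⟨r1, h1, h1'⟩ := h1
  obtain ⟨r2, h2, h2'⟩ := h2
  exact hP d r1 r2 r h1 h2 h1' h2'

lemma split_srt (p : Cell → Bool) (l : List Cell) (h : Srt l)
    (hp : ∀ x ∈ l, ∀ y ∈ l, x.1 < y.1 → p y = true → p x = true) :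
    l = l.filter p ++ l.filter (fun x => !p x) := by
  induction l with
  | nil => rfl
  | cons x l ih =>
    rw [Srt, List.pairwise_cons] at h
    have ih := ih h.2 (fun x hx y hy => hp x (by simp [hx]) y (by simp [hy]))
    by_cases hx : p x = true
    · simp only [List.filter_cons, hx, if_true, Bool.not_true, List.cons_append]
      simpa using ih
    · have : ∀ y ∈ l, p y = false := by
        intro y hy
        by_contra hc
        exact hx (hp x (by simp) y (by simp [hy]) (h.1 y hy) (by simpa using hc))
      have e1 : l.filter p = [] := by
        rw [List.filter_eq_nil_iff]; intro y hy; simp [this y hy]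
      have e2 : l.filter (fun x => !p x) = l := by
        rw [List.filter_eq_self]; intro y hy; simp [this y hy]
      simp [hx, e1, e2]

lemma split3 {P : Finset Cell} (hP : ColConvex P) {c : ℤ} (l : List Cell) (h : Srt l) :
    ∃ l1 l2 l3, l = l1 ++ l2 ++ l3 ∧ (∀ x ∈ l1, Ab P c x.1) ∧ (∀ x ∈ l2, (x.1, c) ∈ P) ∧
      (∀ x ∈ l3, Bl P c x.1 ∧ (x.1, c) ∉ P) := by
  classical
  have s1 := split_srt (fun x => decide (Ab P c x.1)) l h (by
    intro x _ y _ hxy hy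
    simp only [decide_eq_true_eq] at *
    intro r hr; exact hxy.trans (hy r hr))
  have s2 := split_srt (fun x => decide ((x.1, c) ∈ P))
    (l.filter (fun x => !decide (Ab P c x.1))) (List.Pairwise.filter _ h) (by
    intro x hx y hy hxy hy'
    simp only [decide_eq_true_eq, List.mem_filter, Bool.not_eq_true', decide_eq_false_iff_not] at *
    apply tri hP hx.2
    intro hb
    exact absurd (hb _ hy') (not_lt.2 hxy.le))
  refine ⟨l.filter (fun x => decide (Ab P c x.1)),
    (l.filter (fun x => !decide (Ab P c x.1))).filter (fun x => decide ((x.1, c) ∈ P)),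
    (l.filter (fun x => !decide (Ab P c x.1))).filter (fun x => !decide ((x.1, c) ∈ P)),
    ?_, ?_, ?_, ?_⟩
  · rw [List.append_assoc]
    rw [← s2]
    exact s1
  · intro x hx; simpa using (List.mem_filter.1 hx).2
  · intro x hx; simpa using (List.mem_filter.1 hx).2
  · intro x hx
    simp only [List.mem_filter, Bool.not_eq_true', decide_eq_false_iff_not] at hx
    refine ⟨?_, hx.2⟩
    by_contra hb
    exact hx.2 (tri hP hx.1.2 hb)

open scoped Classical in
lemma link (a b s : ℤ → ℕ) (cs : List ℤ) : ∀ (P : Finset Cell) (l : List Cell), OrdP P cs → Srt l →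
    l.toFinset ⊆ P → (∀ c ∈ cs, l.countP (fun x => decide (Ab P c x.1)) = a c) →
    (∀ c ∈ cs, l.countP (fun x => decide (Bl P c x.1)) = b c) →
    (∀ c ∈ cs, (l.map Prod.snd).count c = s c) →
    mz (maxRects P) l.toFinset = (majD a b cs (l.map Prod.snd) : ℤ) ∧
    neP P l.toFinset = neD a b cs (l.map Prod.snd) ∧ l.map Prod.snd ∈ LL a b s cs := by
  induction cs with
  | nil =>
    intro P l hO hl hs _ _ _
    rw [OrdP] at hO
    subst hO
    have : l = [] := by
      have := Finset.subset_empty.1 hs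
      rwa [List.toFinset_eq_empty_iff] at this
    subst this
    refine ⟨?_, ?_, ?_⟩
    · simp [mz, majD, majR_empty]
    · simp [neP, neD]
    · simp [LL]
  | cons c cs ih =>
    intro P l hO hl hs ha hb hc
    obtain ⟨hst, hO'⟩ := hO
    have hnd : c ∉ cs := by rw [hO'.mem_iff, colSet_del]; simp
    obtain ⟨r0, hr0⟩ := mem_colSet.1 hst.mem
    have hdel : del l.toFinset c = (l.filter (fun x => decide (x.2 ≠ c))).toFinset := by
      ext x; simp [del]
    have hmap : (l.map Prod.snd).filter (fun y => decide (y ≠ c))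
        = (l.filter (fun x => decide (x.2 ≠ c))).map Prod.snd := by
      rw [List.filter_map]; rfl
    have hlP : ∀ x ∈ l, x ∈ P := fun x hx => hs (by simpa using hx)
    have hcol : ∀ d ∈ cs, d ≠ c ∧ d ∈ colSet P := by
      intro d hd
      rw [hO'.mem_iff, colSet_del, Finset.mem_erase] at hd
      exact hd
    have hin : ∀ x ∈ l, x.2 = c → (x.1, c) ∈ P := by
      rintro ⟨x, y⟩ hx rfl
      exact hlP _ hx
    obtain ⟨i1, i2, i3⟩ := ih (del P c) (l.filter (fun x => decide (x.2 ≠ c))) hO'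
      (List.Pairwise.filter _ hl) (by
        rw [← hdel]
        exact Finset.filter_subset_filter _ hs)
      (by
        intro d hd
        rw [← ha d (by simp [hd]), List.countP_filter]
        apply List.countP_congr
        intro x hx
        have hd' := hcol d hd
        rw [Bool.and_eq_true, decide_eq_true_iff, decide_eq_true_iff, decide_eq_true_iff]
        simp only [Ab, mem_del]
        constructor
        · intro h r hr; exact h.1 r ⟨hr, hd'.1⟩
        · intro h
          refine ⟨fun r hr => h r hr.1, fun hxc => ?_⟩
          exact lt_irrefl _ (h _ (hst.le d hd'.2 _ (hin x hx hxc))))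
      (by
        intro d hd
        rw [← hb d (by simp [hd]), List.countP_filter]
        apply List.countP_congr
        intro x hx
        have hd' := hcol d hd
        rw [Bool.and_eq_true, decide_eq_true_iff, decide_eq_true_iff, decide_eq_true_iff]
        simp only [Bl, mem_del]
        constructor
        · intro h r hr; exact h.1 r ⟨hr, hd'.1⟩
        · intro h
          refine ⟨fun r hr => h r hr.1, fun hxc => ?_⟩
          exact lt_irrefl _ (h _ (hst.le d hd'.2 _ (hin x hx hxc))))
      (by
        intro d hd
        rw [← hmap, List.count_filter (by simpa using (hcol d hd).1)]
        exact hc d (by simp [hd]))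
    obtain ⟨l1, l2, l3, he, h1, h2, h3⟩ := split3 hst.moon.2.1 (c := c) l hl
    have hnb1 : ∀ x ∈ l1, ¬ Bl P c x.1 := fun x hx hb' => lt_asymm (h1 x hx _ hr0) (hb' _ hr0)
    have hna3 : ∀ x ∈ l3, ¬ Ab P c x.1 := fun x hx hb' => lt_asymm ((h3 x hx).1 _ hr0) (hb' _ hr0)
    have hna2 : ∀ x ∈ l2, ¬ Ab P c x.1 := fun x hx hb' => lt_irrefl _ (hb' _ (h2 x hx))
    have hnb2 : ∀ x ∈ l2, ¬ Bl P c x.1 := fun x hx hb' => lt_irrefl _ (hb' _ (h2 x hx))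
    have hni1 : ∀ x ∈ l1, (x.1, c) ∉ P := fun x hx hb' => lt_irrefl _ (h1 x hx _ hb')
    have L1 : (l1.map Prod.snd).length = a c := by
      rw [← ha c (by simp), he, List.countP_append, List.countP_append, List.length_map,
        List.countP_eq_length.2 (by simpa using fun a b h => h1 (a, b) h),
        List.countP_eq_zero.2 (by simpa using fun a b h => hna2 (a, b) h),
        List.countP_eq_zero.2 (by simpa using fun a b h => hna3 (a, b) h)]
      rfl
    have L3 : (l3.map Prod.snd).length = b c := by
      rw [← hb c (by simp), he, List.countP_append, List.countP_append, List.length_map,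
        List.countP_eq_zero.2 (by simpa using fun a b h => hnb1 (a, b) h),
        List.countP_eq_zero.2 (by simpa using fun a b h => hnb2 (a, b) h),
        List.countP_eq_length.2 (by simpa using fun a b h => (h3 (a, b) h).1)]
      omega
    have hsplit : l.map Prod.snd = l1.map Prod.snd ++ l2.map Prod.snd ++ l3.map Prod.snd := by
      rw [he]; simp
    have hmid : mid (a c) (b c) (l.map Prod.snd) = l2.map Prod.snd := by
      rw [hsplit]; exact mid_append L1 L3
    have hrin : rin P c l.toFinset = l2.toFinset := by
      ext x
      simp only [rin, Finset.mem_filter, List.mem_toFinset, he, List.mem_append]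
      constructor
      · rintro ⟨(h | h) | h, hx⟩
        · exact absurd hx (hni1 x h)
        · exact h
        · exact absurd hx (h3 x h).2
      · intro h; exact ⟨Or.inl (Or.inr h), h2 x h⟩
    have hrin' : rin P c (del l.toFinset c) = (l2.filter (fun x => decide (x.2 ≠ c))).toFinset := by
      have : rin P c (del l.toFinset c) = del (rin P c l.toFinset) c := by
        ext x; simp only [rin, del, Finset.mem_filter]; tauto
      rw [this, hrin]
      ext x; simp [del]
    have hl2 : Srt l2 := by
      have : l2.Sublist l := by
        rw [he, List.append_assoc]
        exact (List.sublist_append_left _ _).trans (List.sublist_append_right _ _)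
      exact List.Pairwise.sublist this hl
    have hmap2 : (l2.map Prod.snd).filter (fun y => decide (y ≠ c))
        = (l2.filter (fun x => decide (x.2 ≠ c))).map Prod.snd := by
      rw [List.filter_map]; rfl
    refine ⟨?_, ?_, ?_⟩
    · rw [maj_step hst hs, hrin, hrin', hdel, i1, majD, hmid, hmap, hmap2, majR_list _ hl2,
        majR_list _ (List.Pairwise.filter _ hl2)]
      have := majL_sublist ((List.filter_sublist (p := fun x : Cell => decide (x.2 ≠ c))
        (l := l2)).map Prod.snd)
      push_cast [Nat.cast_sub this]
      ring
    · rw [ne_step hst hs, hrin, hdel, i2, neD, hmid, hmap, pair_list _ _ hl2]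
    · rw [mem_LL_cons _ _ _ _ _ hnd]
      refine ⟨?_, hc c (by simp), _, _, _, hsplit, L1, L3, ?_, ?_⟩
      · rw [hmap]; exact i3
      · intro hh
        obtain ⟨x, hx, hxc⟩ := List.mem_map.1 hh
        exact hni1 x hx (hin x (by rw [he]; simp [hx]) hxc)
      · intro hh
        obtain ⟨x, hx, hxc⟩ := List.mem_map.1 hh
        exact (h3 x hx).2 (hin x (by rw [he]; simp [hx]) hxc)
lemma srt_unique {l l' : List Cell} (h : Srt l) (h' : Srt l') (he : l.toFinset = l'.toFinset) :
    l = l' :=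
  List.Perm.eq_of_pairwise (fun _ _ _ _ h1 h2 => absurd h2 (lt_asymm h1)) h h'
    (List.perm_of_nodup_nodup_toFinset_eq h.nodup h'.nodup he)

noncomputable def rws (P : Finset Cell) (A : Finset ℤ) : List ℤ :=
  (rowSet P \ A).sort (fun a b => a ≤ b)

lemma rws_pw (P : Finset Cell) (A : Finset ℤ) : (rws P A).Pairwise (· < ·) :=
  (Finset.sortedLT_sort _).pairwise

lemma mem_rws {P : Finset Cell} {A : Finset ℤ} {r : ℤ} : r ∈ rws P A ↔ r ∈ rowSet P ∧ r ∉ A := by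
  simp [rws]

lemma srt_of_map {l : List Cell} (h : (l.map Prod.fst).Pairwise (· < ·)) : Srt l :=
  List.pairwise_map.1 h

lemma card_col {l : List Cell} (h : Srt l) (c : ℤ) :
    (l.toFinset.filter fun x => x.2 = c).card = (l.map Prod.snd).count c := by
  have : l.toFinset.filter (fun x => x.2 = c) = (l.filter (fun x => decide (x.2 = c))).toFinset := by
    ext x; simp
  rw [this, List.toFinset_card_of_nodup (h.nodup.filter _), ← List.countP_eq_length_filter,
    List.count, List.countP_map]
  apply List.countP_congr
  intro x _
  simp

lemma fill_list {P : Finset Cell} {s : ℤ → ℕ} {A : Finset ℤ} {M : Finset Cell}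
    (hM : M ∈ FillSet P s A) : ∃ l, Srt l ∧ l.toFinset = M ∧ M ⊆ P ∧ l.map Prod.fst = rws P A ∧
      ∀ c ∈ colSet P, (l.map Prod.snd).count c = s c := by
  classical
  simp only [FillSet, Finset.mem_filter, Finset.mem_powerset] at hM
  obtain ⟨h1, h2, h3, h4⟩ := hM
  obtain ⟨l, hl, rfl⟩ := exists_srt M h2
  refine ⟨l, hl, rfl, h1, ?_, ?_⟩
  · have hp : (l.map Prod.fst).Pairwise (· < ·) := List.pairwise_map.2 hl
    refine List.Perm.eq_of_pairwise (fun _ _ _ _ h1 h2 => absurd h2 (lt_asymm h1)) hp (rws_pw P A)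
      (List.perm_of_nodup_nodup_toFinset_eq (hp.imp ne_of_lt) ((rws_pw P A).imp ne_of_lt) ?_)
    ext r
    simp only [List.mem_toFinset, List.mem_map, mem_rws]
    constructor
    · rintro ⟨x, hx, rfl⟩
      have hr : x.1 ∈ rowSet P := mem_rowSet.2 ⟨x.2, h1 (by simpa using hx)⟩
      exact ⟨hr, fun hA => (h4 _ hr).1 hA x (by simpa using hx) rfl⟩
    · rintro ⟨hr, hA⟩
      by_contra hc
      apply hA
      rw [h4 r hr]
      intro x hx hxr
      exact hc ⟨x, by simpa using hx, hxr⟩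
  · intro c hc
    rw [← card_col hl, ← h3 c hc]

open scoped Classical in
noncomputable def aP (P : Finset Cell) (A : Finset ℤ) (c : ℤ) : ℕ :=
  (rws P A).countP (fun r => decide (Ab P c r))

open scoped Classical in
noncomputable def bP (P : Finset Cell) (A : Finset ℤ) (c : ℤ) : ℕ :=
  (rws P A).countP (fun r => decide (Bl P c r))

lemma link' {P : Finset Cell} {s : ℤ → ℕ} {A : Finset ℤ} {cs : List ℤ} (hO : OrdP P cs)
    {l : List Cell} (hl : Srt l) (hs : l.toFinset ⊆ P) (hf : l.map Prod.fst = rws P A)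
    (hc : ∀ c ∈ colSet P, (l.map Prod.snd).count c = s c) :
    majP P l.toFinset = majD (aP P A) (bP P A) cs (l.map Prod.snd) ∧
    neP P l.toFinset = neD (aP P A) (bP P A) cs (l.map Prod.snd) ∧
    l.map Prod.snd ∈ LL (aP P A) (bP P A) s cs := by
  classical
  obtain ⟨h1, h2, h3⟩ := link (aP P A) (bP P A) s cs P l hO hl hs
    (by intro c _; rw [aP, ← hf, List.countP_map]; apply List.countP_congr; intro x _; simp)
    (by intro c _; rw [bP, ← hf, List.countP_map]; apply List.countP_congr; intro x _; simp)
    (fun c h => hc c ((hO.mem_iff c).1 h))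
  refine ⟨?_, h2, h3⟩
  rw [majP_eq, h1, Int.toNat_natCast]

lemma zip_good {P : Finset Cell} (hP : IsMoon P) {s : ℤ → ℕ} {A : Finset ℤ} {cs : List ℤ}
    (hO : OrdP P cs) {v : List ℤ} (hv : v ∈ LL (aP P A) (bP P A) s cs)
    {l : List Cell} (hf : l.map Prod.fst = rws P A) (hsn : l.map Prod.snd = v) :
    Srt l ∧ l.toFinset ⊆ P ∧ (∀ c ∈ colSet P, (l.map Prod.snd).count c = s c) ∧
    l.toFinset ∈ FillSet P s A := by
  classical
  have hl : Srt l := srt_of_map (by rw [hf]; exact rws_pw P A)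
  obtain ⟨g1, g2⟩ := good_LL _ _ _ cs hO.nodup v hv
  have hcnt : ∀ c ∈ colSet P, (l.map Prod.snd).count c = s c := by
    intro c hc; rw [hsn]; exact g1 c ((hO.mem_iff c).2 hc)
  have hsub : l.toFinset ⊆ P := by
    rintro ⟨y, d⟩ hx
    obtain ⟨p, q, e⟩ := List.append_of_mem (List.mem_toFinset.1 hx)
    obtain ⟨ga, gb⟩ := g2 (p.map Prod.snd) d (q.map Prod.snd) (by rw [← hsn, e]; simp)
    have er : rws P A = p.map Prod.fst ++ y :: q.map Prod.fst := by rw [← hf, e]; simp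
    have hpw := rws_pw P A
    rw [er, List.pairwise_append, List.pairwise_cons] at hpw
    rw [List.length_map] at ga gb
    apply tri hP.2.1
    · intro hab
      have : (p.map Prod.fst).countP (fun r => decide (Ab P d r)) = (p.map Prod.fst).length := by
        rw [List.countP_eq_length]
        intro r hr
        rw [decide_eq_true_iff]
        intro r' hr'
        exact (hpw.2.2 r hr y (by simp)).trans (hab r' hr')
      rw [aP, er, List.countP_append, this, List.countP_cons_of_pos (by simpa using hab),
        List.length_map] at ga
      omega
    · intro hab
      have : (q.map Prod.fst).countP (fun r => decide (Bl P d r)) = (q.map Prod.fst).length := by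
        rw [List.countP_eq_length]
        intro r hr
        rw [decide_eq_true_iff]
        intro r' hr'
        exact (hab r' hr').trans (hpw.2.1.1 r hr)
      rw [bP, er, List.countP_append, List.countP_cons_of_pos (by simpa using hab), this,
        List.length_map] at gb
      omega
  refine ⟨hl, hsub, hcnt, ?_⟩
  simp only [FillSet, Finset.mem_filter, Finset.mem_powerset]
  refine ⟨hsub, ?_, ?_, ?_⟩
  · intro x hx y hy hxy
    rw [List.mem_toFinset] at hx hy
    by_contra hne
    have : Std.Symm (fun x y : Cell => x.1 = y.1 → x = y) := ⟨fun _ _ h e => (h e.symm).symm⟩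
    have := List.Pairwise.forall_of_forall (R := fun x y : Cell => x.1 = y.1 → x = y)
      (l := l)
      (fun _ _ _ => rfl) (List.Pairwise.imp (fun h e => absurd e (ne_of_lt h)) hl) hx hy
    exact hne (this hxy)
  · intro c hc
    rw [← hcnt c hc, ← card_col hl]
  · intro r hr
    have := mem_rws (P := P) (A := A) (r := r)
    rw [← hf] at this
    constructor
    · intro hA x hx hxr
      exact (this.1 (List.mem_map.2 ⟨x, by simpa using hx, hxr⟩)).2 hA
    · intro h
      by_contra hA
      obtain ⟨x, hx, hxr⟩ := List.mem_map.1 (this.2 ⟨hr, hA⟩)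
      exact h x (by simpa using hx) hxr

lemma main_sum (P : Finset Cell) (hP : IsMoon P) (s : ℤ → ℕ) (A : Finset ℤ) :
    ∑ M ∈ FillSet P s A, (Polynomial.X : Polynomial ℤ) ^ majP P M
      = ∑ M ∈ FillSet P s A, (Polynomial.X : Polynomial ℤ) ^ neP P M := by
  classical
  rcases (FillSet P s A).eq_empty_or_nonempty with h0 | ⟨M0, hM0⟩
  · rw [h0]; simp
  obtain ⟨cs, hO⟩ := exists_ord _ P rfl hP
  have hlen : (rws P A).length = (cs.map s).sum := by
    obtain ⟨l, hl, rfl, hsub, hf, hc⟩ := fill_list hM0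
    have := length_LL _ _ _ _ _ (link' hO hl hsub hf hc).2.2
    rw [← this, ← hf]; simp
  have hz : ∀ v ∈ LL (aP P A) (bP P A) s cs, ((rws P A).zip v).map Prod.fst = rws P A ∧
      ((rws P A).zip v).map Prod.snd = v := by
    intro v hv
    have := length_LL _ _ _ _ _ hv
    exact ⟨List.map_fst_zip (by omega), List.map_snd_zip (by omega)⟩
  have hz2 := fun v hv => zip_good hP hO hv (hz v hv).1 (hz v hv).2
  have hz3 := fun v hv => link' hO (hz2 v hv).1 (hz2 v hv).2.1 (hz v hv).1 (hz2 v hv).2.2.1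
  have key : ∀ (f : Finset Cell → ℕ) (g : List ℤ → ℕ),
      (∀ v ∈ LL (aP P A) (bP P A) s cs, f ((rws P A).zip v).toFinset = g v) →
      ∑ v ∈ LL (aP P A) (bP P A) s cs, (Polynomial.X : Polynomial ℤ) ^ g v
        = ∑ M ∈ FillSet P s A, (Polynomial.X : Polynomial ℤ) ^ f M := by
    intro f g hfg
    refine Finset.sum_bij (fun v _ => ((rws P A).zip v).toFinset) ?_ ?_ ?_ ?_
    · intro v hv; exact (hz2 v hv).2.2.2
    · intro v hv w hw h
      have := srt_unique (hz2 v hv).1 (hz2 w hw).1 h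
      rw [← (hz v hv).2, this, (hz w hw).2]
    · intro M hM
      obtain ⟨l, hl, rfl, hsub, hf, hc⟩ := fill_list hM
      refine ⟨l.map Prod.snd, (link' hO hl hsub hf hc).2.2, ?_⟩
      rw [← List.zip_of_prod hf rfl]
    · intro v hv; rw [hfg v hv]
  rw [← key (majP P) (majD (aP P A) (bP P A) cs) (fun v hv => by
      have := (hz3 v hv).1; rwa [(hz v hv).2] at this),
    ← key (neP P) (neD (aP P A) (bP P A) cs) (fun v hv => by
      have := (hz3 v hv).2.1; rwa [(hz v hv).2] at this)]
  exact equi_LL _ _ _ cs hO.ext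

lemma coeff_sum (S : Finset (Finset Cell)) (f : Finset Cell → ℕ) (t : ℕ) :
    (∑ M ∈ S, (Polynomial.X : Polynomial ℤ) ^ f M).coeff t
      = ((S.filter fun M => f M = t).card : ℤ) := by
  rw [Polynomial.finsetSum_coeff, Finset.card_filter]
  push_cast
  apply Finset.sum_congr rfl
  intro M _
  rw [Polynomial.coeff_X_pow]
  simp [eq_comm]

/-- **Theorem (STATEMENT 2).** The major index and the number of north-east chains are
equidistributed over `F(𝓜,s;A)`: for every `t` the number of fillings with `maj = t`
equals the number of fillings with `ne = t`; equivalently the generating functions agree. -/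
theorem maj_ne_equidistributed (P : Finset Cell) (hP : IsMoon P)
    (s : ℤ → ℕ) (A : Finset ℤ) (hA : A ⊆ rowSet P) :
    (∀ t : ℕ,
      ((FillSet P s A).filter fun M => majP P M = t).card
        = ((FillSet P s A).filter fun M => neP P M = t).card) ∧
    ∑ M ∈ FillSet P s A, (Polynomial.X : Polynomial ℤ) ^ majP P M
      = ∑ M ∈ FillSet P s A, (Polynomial.X : Polynomial ℤ) ^ neP P M := by
  have h := main_sum P hP s A
  refine ⟨fun t => ?_, h⟩
  have h2 := congrArg (fun p => Polynomial.coeff p t) h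
  simp only [coeff_sum] at h2
  exact_mod_cast h2

end MoonPolyomino
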